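/- Let (G, {G_(i)}) be a p-filtered group of order p^n. Then there exists a real number M ≥ 1, depending only on (G, {G_(i)}), with the following property: for every local field K of characteristic p with perfect residue field and every sequence of positive integers u_1, ..., u_n with p ∤ u_i for 1 ≤ i ≤ n and u_{i+1} > M u_i for 1 ≤ i ≤ n−1, there exists a totally ramified Galois extension L/K such that (a) Gal(L/K) ≅ G, (b) the upper ramification breaks of L/K are u_1, ..., u_n, and (c) the ramification subgroups of Gal(L/K) ≅ G are exactly the groups G_(i) of the filtration. -/

import Mathlib

/-!
STATEMENT 15 (Corollary 4.6 of the paper):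
Let (G, {G_(i)}) be a p-filtered group of order p^n.  Then there is M ≥ 1, depending only
on (G, {G_(i)}), such that: for every local field K of characteristic p with perfect
residue field and all positive integers u_1, ..., u_n with p ∤ u_i and u_{i+1} > M u_i,
there is a totally ramified Galois extension L/K with (a) Gal(L/K) ≅ G, (b) upper
ramification breaks u_1, ..., u_n, and (c) ramification subgroups exactly the G_(i).
-/

universe u

/-- A normalized discrete valuation on a field `K` (so `v(K×) = ℤ`). -/
structure DVal (K : Type*) [Field K] where
  v : K → ℤ
  v_one : v 1 = 0
  v_mul : ∀ x y : K, x ≠ 0 → y ≠ 0 → v (x * y) = v x + v y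
  v_add : ∀ x y : K, x ≠ 0 → y ≠ 0 → x + y ≠ 0 → min (v x) (v y) ≤ v (x + y)
  exists_uniformizer : ∃ π : K, π ≠ 0 ∧ v π = 1

/-- `K` is complete with respect to the discrete valuation `vK`. -/
def DVal.IsComplete {K : Type*} [Field K] (vK : DVal K) : Prop :=
  ∀ f : ℕ → K,
    (∀ N : ℤ, ∃ M : ℕ, ∀ m n : ℕ, M ≤ m → M ≤ n → f m = f n ∨ N ≤ vK.v (f m - f n)) →
    ∃ a : K, ∀ N : ℤ, ∃ M : ℕ, ∀ m : ℕ, M ≤ m → f m = a ∨ N ≤ vK.v (f m - a)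

/-- The residue field of `(K, vK)` is perfect (in characteristic `p` this says the
Frobenius is surjective on the residue field). -/
def DVal.PerfectResidue {K : Type*} [Field K] (vK : DVal K) (p : ℕ) : Prop :=
  ∀ x : K, (x = 0 ∨ 0 ≤ vK.v x) →
    ∃ y : K, (y = 0 ∨ 0 ≤ vK.v y) ∧ (x - y ^ p = 0 ∨ 1 ≤ vK.v (x - y ^ p))

/-- `σ` belongs to the inertia subgroup: it induces the identity on the residue field. -/
def inInertia (K : Type*) {L : Type*} [Field K] [Field L] [Algebra K L]
    (vL : DVal L) (σ : L ≃ₐ[K] L) : Prop :=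
  ∀ x : L, (x = 0 ∨ 0 ≤ vL.v x) → (σ x - x = 0 ∨ 1 ≤ vL.v (σ x - x))

/-- The ramification number `i(σ) = v_L(σ(π_L) − π_L) − 1` for `σ` in the inertia group,
and `i(σ) = −1` otherwise. -/
noncomputable def ramNum (K : Type*) {L : Type*} [Field K] [Field L] [Algebra K L]
    (vL : DVal L) (πL : L) (σ : L ≃ₐ[K] L) : ℤ := by
  classical exact if inInertia K vL σ then vL.v (σ πL - πL) - 1 else -1

/-- The lower ramification set `G_t = {σ : i(σ) ≥ t}` (together with the identity). -/
def lowerSet (K : Type*) {L : Type*} [Field K] [Field L] [Algebra K L]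
    (vL : DVal L) (πL : L) (t : ℝ) : Set (L ≃ₐ[K] L) :=
  {σ | σ = 1 ∨ (t ≤ (ramNum K vL πL σ : ℝ))}

/-- `b` is a lower ramification break of `L/K`. -/
def IsLowerBreak (K : Type*) {L : Type*} [Field K] [Field L] [Algebra K L]
    (vL : DVal L) (πL : L) (b : ℝ) : Prop :=
  ∃ σ : L ≃ₐ[K] L, σ ≠ 1 ∧ (ramNum K vL πL σ : ℝ) = b

/-- The Hasse–Herbrand function `φ_{L/K}(x) = ∫_0^x dt / (G_0 : G_t)`. -/
noncomputable def hherb (K : Type*) {L : Type*} [Field K] [Field L] [Algebra K L]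
    (vL : DVal L) (πL : L) (x : ℝ) : ℝ :=
  ∫ t in (0:ℝ)..x,
    (Nat.card ↥(lowerSet K vL πL t) : ℝ) / (Nat.card ↥(lowerSet K vL πL 0) : ℝ)

/-- `u` is an upper ramification break of `L/K`:  `ψ_{L/K}(u)` is a lower break. -/
def IsUpperBreak (K : Type*) {L : Type*} [Field K] [Field L] [Algebra K L]
    (vL : DVal L) (πL : L) (u : ℝ) : Prop :=
  ∃ b : ℝ, IsLowerBreak K vL πL b ∧ hherb K vL πL b = u

/-- A witness for the conclusion of the corollary: a totally ramified G-extension L/K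
with upper ramification breaks u_1 < ... < u_n whose ramification subgroups correspond
to the groups of the filtration under μ. -/
structure RamifiedGWitness (p n : ℕ) (K : Type u) [Field K] (vK : DVal K)
    (G : Type*) [Group G] (Gser : ℕ → Subgroup G) (u : ℕ → ℤ) where
  L : Type u
  [fieldL : Field L]
  [algL : Algebra K L]
  vL : DVal L
  πL : L
  μ : (L ≃ₐ[K] L) ≃* G
  galois : IsGalois K L
  findim : FiniteDimensional K L
  unif : πL ≠ 0 ∧ vL.v πL = 1
  inv : ∀ σ : L ≃ₐ[K] L, ∀ x : L, vL.v (σ x) = vL.v x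
  -- L/K is totally ramified of degree p^n
  totram : ∀ x : K, x ≠ 0 → vL.v (algebraMap K L x) = (p : ℤ) ^ n * vK.v x
  -- the upper ramification breaks of L/K are u_1, ..., u_n
  upper : ∀ x : ℝ, IsUpperBreak K vL πL x ↔ ∃ i, 1 ≤ i ∧ i ≤ n ∧ x = ((u i : ℤ) : ℝ)
  -- the ramification subgroups of Gal(L/K) ≅ G are exactly the groups G_(i)
  ramsub₁ : ∀ t : ℝ, ∃ i, i ≤ n ∧
    (fun σ => μ σ) '' lowerSet K vL πL t = (Gser i : Set G)
  ramsub₂ : ∀ i, i ≤ n → ∃ t : ℝ,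
    (fun σ => μ σ) '' lowerSet K vL πL t = (Gser i : Set G)


namespace DVal

variable {K : Type*} [Field K] (v : DVal K)

/-- `x` lies in the `m`-th power of the maximal ideal. -/
def Ge (x : K) (m : ℤ) : Prop := x = 0 ∨ m ≤ v.v x

/-- `x` has valuation exactly `m`. -/
def Is (x : K) (m : ℤ) : Prop := x ≠ 0 ∧ v.v x = m

variable {v}

theorem Is.ge {x : K} {m : ℤ} (h : v.Is x m) : v.Ge x m := Or.inr h.2.ge

theorem Ge.mono {x : K} {m k : ℤ} (h : v.Ge x m) (hk : k ≤ m) : v.Ge x k :=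
  h.imp id fun h => hk.trans h

theorem ge_zero (m : ℤ) : v.Ge 0 m := Or.inl rfl

theorem Is.congr {x : K} {m k : ℤ} (h : v.Is x m) (hk : m = k) : v.Is x k := hk ▸ h

theorem is_one : v.Is 1 0 := ⟨one_ne_zero, v.v_one⟩

theorem Is.mul {x y : K} {m k : ℤ} (h : v.Is x m) (h' : v.Is y k) : v.Is (x * y) (m + k) :=
  ⟨mul_ne_zero h.1 h'.1, by rw [v.v_mul _ _ h.1 h'.1, h.2, h'.2]⟩

theorem Ge.is_of_ne {x : K} {m : ℤ} (_h : v.Ge x m) (h0 : x ≠ 0) : v.Is x (v.v x) := ⟨h0, rfl⟩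

theorem Ge.mul {x y : K} {m k : ℤ} (h : v.Ge x m) (h' : v.Ge y k) : v.Ge (x * y) (m + k) := by
  rcases h with rfl | h
  · left; simp
  rcases h' with rfl | h'
  · left; simp
  by_cases hx : x = 0
  · left; simp [hx]
  by_cases hy : y = 0
  · left; simp [hy]
  right
  rw [v.v_mul _ _ hx hy]; omega

theorem Ge.add {x y : K} {m : ℤ} (h : v.Ge x m) (h' : v.Ge y m) : v.Ge (x + y) m := by
  by_cases hx : x = 0
  · simpa [hx] using h'
  by_cases hy : y = 0
  · simpa [hy] using h
  by_cases hxy : x + y = 0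
  · exact Or.inl hxy
  right
  have := v.v_add x y hx hy hxy
  have h1 := h.resolve_left hx
  have h2 := h'.resolve_left hy
  exact (le_min h1 h2).trans this

theorem v_neg_one : v.v (-1) = 0 := by
  have h1 : (-1 : K) ≠ 0 := neg_ne_zero.mpr one_ne_zero
  have := v.v_mul (-1) (-1) h1 h1
  simp [v.v_one] at this
  omega

theorem is_neg_one : v.Is (-1) 0 := ⟨neg_ne_zero.mpr one_ne_zero, v_neg_one⟩

theorem Ge.neg {x : K} {m : ℤ} (h : v.Ge x m) : v.Ge (-x) m := by
  have := (is_neg_one (v := v)).ge.mul h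
  simpa using this

theorem Is.neg {x : K} {m : ℤ} (h : v.Is x m) : v.Is (-x) m := by
  have := (is_neg_one (v := v)).mul h
  simpa using this

theorem Ge.sub {x y : K} {m : ℤ} (h : v.Ge x m) (h' : v.Ge y m) : v.Ge (x - y) m := by
  rw [sub_eq_add_neg]; exact h.add h'.neg

theorem Ge.sum {ι : Type*} (s : Finset ι) (f : ι → K) {m : ℤ} (h : ∀ i ∈ s, v.Ge (f i) m) :
    v.Ge (∑ i ∈ s, f i) m := by
  classical
  induction s using Finset.induction_on with
  | empty => simpa using ge_zero m
  | insert a s ha ih =>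
    rw [Finset.sum_insert ha]
    exact (h a (Finset.mem_insert_self a s)).add
      (ih fun i hi => h i (Finset.mem_insert_of_mem hi))

theorem Is.pow {x : K} {m : ℤ} (h : v.Is x m) (k : ℕ) : v.Is (x ^ k) (k * m) := by
  induction k with
  | zero => simpa using is_one
  | succ k ih =>
    rw [pow_succ]
    exact (ih.mul h).congr (by push_cast; ring)

theorem Ge.pow {x : K} {m : ℤ} (h : v.Ge x m) (k : ℕ) : v.Ge (x ^ k) (k * m) := by
  induction k with
  | zero => simpa using is_one.ge
  | succ k ih =>
    rw [pow_succ]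
    exact (ih.mul h).mono (by push_cast; linarith)

theorem Is.not_ge {x : K} {m k : ℤ} (h : v.Is x m) (hk : m < k) : ¬ v.Ge x k := by
  rintro (h' | h')
  · exact h.1 h'
  · have := h.2; omega

theorem Is.unique {x : K} {m k : ℤ} (h : v.Is x m) (h' : v.Is x k) : m = k :=
  h.2.symm.trans h'.2

theorem is_of_ge {x : K} {m : ℤ} (h : v.Ge x m) (h' : ¬ v.Ge x (m + 1)) : v.Is x m := by
  have hx : x ≠ 0 := fun hx => h' (Or.inl hx)
  refine ⟨hx, ?_⟩
  have h1 := h.resolve_left hx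
  have h2 : ¬ (m + 1 ≤ v.v x) := fun h2 => h' (Or.inr h2)
  omega

theorem Is.add_ge {x y : K} {m : ℤ} (h : v.Is x m) (h' : v.Ge y (m + 1)) : v.Is (x + y) m := by
  apply is_of_ge
  · exact h.ge.add (h'.mono (by omega))
  · intro h2
    have := h2.sub h'
    rw [add_sub_cancel_right] at this
    exact h.not_ge (by omega) this

theorem Is.inv {x : K} {m : ℤ} (h : v.Is x m) : v.Is x⁻¹ (-m) := by
  have hx := inv_ne_zero h.1
  refine ⟨hx, ?_⟩
  have := v.v_mul x x⁻¹ h.1 hx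
  rw [mul_inv_cancel₀ h.1, v.v_one, h.2] at this
  omega

theorem exists_is (v : DVal K) (m : ℤ) : ∃ x, v.Is x m := by
  obtain ⟨π, h0, h1⟩ := v.exists_uniformizer
  have hπ : v.Is π 1 := ⟨h0, h1⟩
  obtain ⟨k, rfl | rfl⟩ := m.eq_nat_or_neg
  · exact ⟨π ^ k, (hπ.pow k).congr (by ring)⟩
  · exact ⟨(π ^ k)⁻¹, (hπ.pow k).inv.congr (by ring)⟩

theorem is_self {x : K} (h : x ≠ 0) : v.Is x (v.v x) := ⟨h, rfl⟩

/-- Dividing out. -/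
theorem Is.of_mul_ge {x y : K} {m k : ℤ} (h : v.Is x m) (h' : v.Ge (x * y) k) :
    v.Ge y (k - m) := by
  have := h.inv.ge.mul h'
  rw [← mul_assoc, inv_mul_cancel₀ h.1, one_mul] at this
  exact this.mono (by omega)

end DVal

section Extension

variable {F : Type*} [Field F] {A : Type*} [CommRing A] [Algebra F A] {p : ℕ}

/-- coefficientwise lower bound on the candidate valuation -/
def GeA (v : DVal F) (bas : Module.Basis (Fin p) F A) (b : ℤ) (y : A) (m : ℤ) : Prop :=
  ∀ i : Fin p, bas.repr y i ≠ 0 → m ≤ p * v.v (bas.repr y i) - (i : ℕ) * b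

/-- `y` has a leading monomial of valuation `m` -/
def LdA (v : DVal F) (bas : Module.Basis (Fin p) F A) (x : A) (b : ℤ) (y : A) (m : ℤ) : Prop :=
  ∃ (i : ℕ) (c : F), i < p ∧ c ≠ 0 ∧ m = p * v.v c - i * b ∧
    GeA v bas b (y - algebraMap F A c * x ^ i) (m + 1)

variable {v : DVal F} {bas : Module.Basis (Fin p) F A} {b : ℤ} {x : A}

theorem GeA.mono {y : A} {m k : ℤ} (h : GeA v bas b y m) (hk : k ≤ m) : GeA v bas b y k :=
  fun i hi => hk.trans (h i hi)

theorem geA_iff {y : A} {m : ℤ} : GeA v bas b y m ↔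
    ∀ i : Fin p, bas.repr y i = 0 ∨ m ≤ p * v.v (bas.repr y i) - (i : ℕ) * b :=
  forall_congr' fun i => or_iff_not_imp_left.symm

theorem GeA.add (hp0 : 0 < p) {y z : A} {m : ℤ} (h : GeA v bas b y m) (h' : GeA v bas b z m) :
    GeA v bas b (y + z) m := by
  intro i hi
  rw [map_add, Finsupp.add_apply] at hi ⊢
  by_cases hy : bas.repr y i = 0
  · rw [hy, zero_add] at hi ⊢; exact h' i hi
  by_cases hz : bas.repr z i = 0
  · rw [hz, add_zero] at hi ⊢; exact h i hy
  have h1 := h i hy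
  have h2 := h' i hz
  have h3 := v.v_add _ _ hy hz hi
  have hp' : (0 : ℤ) < p := by exact_mod_cast hp0
  rcases min_le_iff.mp h3 with h4 | h4 <;> nlinarith

theorem geA_zero (m : ℤ) : GeA v bas b 0 m := by
  intro i hi; simp at hi

theorem GeA.neg {y : A} {m : ℤ} (h : GeA v bas b y m) : GeA v bas b (-y) m := by
  intro i hi
  rw [map_neg, Finsupp.neg_apply] at hi ⊢
  have hi' := neg_ne_zero.mp hi
  rw [((DVal.is_self (v := v) hi').neg).2]
  exact h i hi'

theorem GeA.sum (hp0 : 0 < p) {ι : Type*} (s : Finset ι) (f : ι → A) {m : ℤ}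
    (h : ∀ i ∈ s, GeA v bas b (f i) m) : GeA v bas b (∑ i ∈ s, f i) m := by
  classical
  induction s using Finset.induction_on with
  | empty => simpa using geA_zero m
  | insert a s ha ih =>
    rw [Finset.sum_insert ha]
    exact (h a (Finset.mem_insert_self a s)).add hp0
      (ih fun i hi => h i (Finset.mem_insert_of_mem hi))

theorem repr_monomial (hb : ∀ i : Fin p, bas i = x ^ (i : ℕ)) (c : F) (i : Fin p) :
    bas.repr (algebraMap F A c * x ^ (i : ℕ)) = Finsupp.single i c := by
  rw [← hb, ← Algebra.smul_def, map_smul, Module.Basis.repr_self]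
  simp

theorem sum_monomial (hb : ∀ i : Fin p, bas i = x ^ (i : ℕ)) (y : A) :
    y = ∑ i : Fin p, algebraMap F A (bas.repr y i) * x ^ (i : ℕ) := by
  conv_lhs => rw [← bas.sum_repr y]
  refine Finset.sum_congr rfl fun i _ => ?_
  rw [← hb, Algebra.smul_def]

theorem geA_monomial_lt (hb : ∀ i : Fin p, bas i = x ^ (i : ℕ)) {c : F} (i : ℕ)
    (hi : i < p) {m : ℤ} (hm : c ≠ 0 → m ≤ p * v.v c - i * b) :
    GeA v bas b (algebraMap F A c * x ^ i) m := by
  intro k hk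
  have hr := repr_monomial hb c ⟨i, hi⟩
  simp only at hr
  rw [hr] at hk ⊢
  by_cases hik : k = ⟨i, hi⟩
  · subst hik
    simp only [Finsupp.single_eq_same] at hk ⊢
    exact hm hk
  · simp [Finsupp.single_apply, Ne.symm hik] at hk

variable {D : F}

theorem geA_monomial (hb : ∀ i : Fin p, bas i = x ^ (i : ℕ)) (hp1 : 1 < p)
    (hx : x ^ p = x + algebraMap F A D) (hD : v.Is D (-b)) (hb0 : 0 ≤ b)
    (i : ℕ) : ∀ {c : F} {m : ℤ} (_hm : c ≠ 0 → m ≤ p * v.v c - i * b),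
    GeA v bas b (algebraMap F A c * x ^ i) m := by
  induction i using Nat.strong_induction_on with
  | _ i ih =>
    intro c m hm
    by_cases hi : i < p
    · exact geA_monomial_lt hb i hi hm
    push Not at hi
    obtain ⟨k, rfl⟩ := Nat.exists_eq_add_of_le hi
    have e : algebraMap F A c * x ^ (p + k) =
        algebraMap F A c * x ^ (k + 1) + algebraMap F A (c * D) * x ^ k := by
      rw [pow_add, hx, map_mul]; ring
    rw [e]
    refine (ih (k + 1) (by omega) fun hc => ?_).add (by omega) (ih k (by omega) fun hc => ?_)
    · have := hm hc
      have hp' : (1 : ℤ) ≤ p := by exact_mod_cast hp1.le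
      push_cast at this ⊢
      nlinarith
    · have hc' : c ≠ 0 := left_ne_zero_of_mul hc
      have := hm hc'
      rw [v.v_mul _ _ hc' hD.1, hD.2]
      push_cast at this ⊢
      linarith

theorem GeA.mul (hb : ∀ i : Fin p, bas i = x ^ (i : ℕ)) (hp1 : 1 < p)
    (hx : x ^ p = x + algebraMap F A D) (hD : v.Is D (-b)) (hb0 : 0 ≤ b)
    {y z : A} {m k : ℤ} (h : GeA v bas b y m) (h' : GeA v bas b z k) :
    GeA v bas b (y * z) (m + k) := by
  rw [sum_monomial hb y, sum_monomial hb z, Finset.sum_mul_sum]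
  refine GeA.sum (by omega) _ _ fun i _ => GeA.sum (by omega) _ _ fun j _ => ?_
  have e : algebraMap F A (bas.repr y i) * x ^ (i : ℕ) * (algebraMap F A (bas.repr z j) * x ^ (j : ℕ))
      = algebraMap F A (bas.repr y i * bas.repr z j) * x ^ ((i : ℕ) + j) := by
    rw [map_mul, pow_add]; ring
  rw [e]
  refine geA_monomial hb hp1 hx hD hb0 _ fun hc => ?_
  have h1 := left_ne_zero_of_mul hc
  have h2 := right_ne_zero_of_mul hc
  have h3 := h i h1
  have h4 := h' j h2
  rw [v.v_mul _ _ h1 h2]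
  push_cast
  linarith

theorem distinct_aux (hp : p.Prime) (hpb : ¬ (p : ℤ) ∣ b) {i j : ℕ} (hi : i < p) (hj : j < p)
    {s t : ℤ} (h : p * s - i * b = p * t - j * b) : i = j := by
  have h1 : (p : ℤ) ∣ ((i : ℤ) - j) * b := ⟨s - t, by linarith⟩
  have h2 := (Nat.prime_iff_prime_int.mp hp).dvd_or_dvd h1
  rcases h2 with h2 | h2
  · have h3 := Int.eq_zero_of_abs_lt_dvd h2 (by rw [abs_lt]; constructor <;> omega)
    omega
  · exact absurd h2 hpb

theorem exists_ldA (hb : ∀ i : Fin p, bas i = x ^ (i : ℕ)) (hp : p.Prime)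
    (hpb : ¬ (p : ℤ) ∣ b) {y : A} (hy : y ≠ 0) : ∃ m, LdA v bas x b y m := by
  classical
  have hne : (Finset.univ.filter fun i : Fin p => bas.repr y i ≠ 0).Nonempty := by
    by_contra hcon
    rw [Finset.not_nonempty_iff_eq_empty, Finset.filter_eq_empty_iff] at hcon
    apply hy
    have : bas.repr y = 0 := by
      ext i
      have := hcon (Finset.mem_univ i)
      push Not at this
      simpa using this
    simpa using this
  obtain ⟨i, hi, hmin⟩ := Finset.exists_min_image _
    (fun i : Fin p => (p : ℤ) * v.v (bas.repr y i) - (i : ℕ) * b) hne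
  rw [Finset.mem_filter] at hi
  refine ⟨_, i, bas.repr y i, i.2, hi.2, rfl, ?_⟩
  intro k hk
  rw [map_sub, repr_monomial hb, Finsupp.sub_apply] at hk ⊢
  by_cases hki : k = i
  · subst hki; simp at hk
  · have hs : (Finsupp.single i (bas.repr y i)) k = 0 := by
      simp [Finsupp.single_apply, Ne.symm hki]
    rw [hs, sub_zero] at hk ⊢
    have h1 := hmin k (by simp [hk])
    rcases h1.lt_or_eq with h1 | h1
    · exact h1
    · exact absurd (Fin.ext (distinct_aux hp hpb i.2 k.2 h1)).symm hki

theorem LdA.geA (hb : ∀ i : Fin p, bas i = x ^ (i : ℕ)) (hp0 : 0 < p) {y : A} {m : ℤ}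
    (h : LdA v bas x b y m) : GeA v bas b y m := by
  obtain ⟨i, c, hi, hc, rfl, hr⟩ := h
  have := (geA_monomial_lt (v := v) (b := b) hb i hi (fun _ : c ≠ 0 => le_refl _)).add hp0
    (hr.mono (by omega))
  rwa [add_sub_cancel] at this

theorem LdA.not_geA (hb : ∀ i : Fin p, bas i = x ^ (i : ℕ)) (hp0 : 0 < p) {y : A} {m k : ℤ}
    (h : LdA v bas x b y m) (hk : m < k) : ¬ GeA v bas b y k := by
  obtain ⟨i, c, hi, hc, rfl, hr⟩ := h
  intro h'
  have h1 := (h'.mono (show _ + 1 ≤ k by omega)).add hp0 hr.neg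
  rw [← sub_eq_add_neg, sub_sub_cancel] at h1
  have h2 := repr_monomial hb c ⟨i, hi⟩
  have h3 := h1 ⟨i, hi⟩
  simp only at h2
  rw [h2] at h3
  simp only [Finsupp.single_eq_same] at h3
  have := h3 hc
  omega

theorem LdA.mul (hb : ∀ i : Fin p, bas i = x ^ (i : ℕ)) (hp1 : 1 < p)
    (hx : x ^ p = x + algebraMap F A D) (hD : v.Is D (-b)) (hb0 : 0 < b)
    {y z : A} {m k : ℤ} (h : LdA v bas x b y m) (h' : LdA v bas x b z k) :
    LdA v bas x b (y * z) (m + k) := by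
  have gy := h.geA hb (by omega)
  have gz := h'.geA hb (by omega)
  obtain ⟨i, c, hi, hc, hm, hr⟩ := h
  obtain ⟨j, d, hj, hd, hk, hs⟩ := h'
  have hcx : GeA v bas b (algebraMap F A c * x ^ i) m :=
    geA_monomial_lt hb i hi (fun _ => hm.le)
  have key : GeA v bas b (y * z - algebraMap F A (c * d) * x ^ (i + j)) (m + k + 1) := by
    have e : y * z - algebraMap F A (c * d) * x ^ (i + j) =
        (y - algebraMap F A c * x ^ i) * z
        + (algebraMap F A c * x ^ i) * (z - algebraMap F A d * x ^ j) := by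
      rw [map_mul, pow_add]; ring
    rw [e]
    exact ((hr.mul hb hp1 hx hD hb0.le gz).mono (by omega)).add (by omega)
      ((hcx.mul hb hp1 hx hD hb0.le hs).mono (by omega))
  by_cases hij : i + j < p
  · refine ⟨i + j, c * d, hij, mul_ne_zero hc hd, ?_, key⟩
    rw [v.v_mul _ _ hc hd, hm, hk]; push_cast; ring
  · push Not at hij
    obtain ⟨t, ht⟩ := Nat.exists_eq_add_of_le hij
    have hcd := mul_ne_zero hc hd
    have hv : v.v (c * d) = v.v c + v.v d := v.v_mul _ _ hc hd
    have ht' : (i : ℤ) + j = p + t := by exact_mod_cast ht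
    refine ⟨t, c * d * D, by omega, mul_ne_zero hcd hD.1, ?_, ?_⟩
    · rw [v.v_mul _ _ hcd hD.1, hv, hD.2, hm, hk]
      linear_combination -b * ht'
    · have e : y * z - algebraMap F A (c * d * D) * x ^ t =
          (y * z - algebraMap F A (c * d) * x ^ (i + j)) + algebraMap F A (c * d) * x ^ (t + 1) := by
        rw [ht, pow_add, hx, map_mul _ (c * d) D]; ring
      rw [e]
      refine key.add (by omega) (geA_monomial hb hp1 hx hD hb0.le _ fun _ => ?_)
      rw [hv, hm, hk]
      have hp' : (2 : ℤ) ≤ p := by exact_mod_cast hp1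
      push_cast
      have hj' : (j : ℤ) * b = (p + t - i) * b := by rw [← ht']; ring
      nlinarith

theorem LdA.ne_zero (hb : ∀ i : Fin p, bas i = x ^ (i : ℕ)) (hp0 : 0 < p) {y : A} {m : ℤ}
    (h : LdA v bas x b y m) : y ≠ 0 := by
  rintro rfl
  exact h.not_geA hb hp0 (lt_add_one m) (geA_zero _)

theorem LdA.unique (hb : ∀ i : Fin p, bas i = x ^ (i : ℕ)) (hp0 : 0 < p) {y : A} {m k : ℤ}
    (h : LdA v bas x b y m) (h' : LdA v bas x b y k) : m = k := by
  by_contra hne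
  rcases lt_or_gt_of_ne hne with hlt | hlt
  · exact h.not_geA hb hp0 hlt (h'.geA hb hp0)
  · exact h'.not_geA hb hp0 hlt (h.geA hb hp0)

theorem noZeroDivisors_ext (hb : ∀ i : Fin p, bas i = x ^ (i : ℕ)) (hp : p.Prime)
    (hx : x ^ p = x + algebraMap F A D) (hD : v.Is D (-b)) (hb0 : 0 < b)
    (hpb : ¬ (p : ℤ) ∣ b) : NoZeroDivisors A := by
  constructor
  intro y z hyz
  by_contra hcon
  push Not at hcon
  obtain ⟨m, hm⟩ := exists_ldA (v := v) hb hp hpb hcon.1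
  obtain ⟨k, hk⟩ := exists_ldA (v := v) hb hp hpb hcon.2
  exact (hm.mul hb hp.one_lt hx hD hb0 hk).ne_zero hb hp.pos hyz

end Extension

theorem exists_ext_val {F : Type*} [Field F] {L : Type*} [Field L] [Algebra F L] {p : ℕ}
    {v : DVal F} {bas : Module.Basis (Fin p) F L} {b : ℤ} {x : L} {D : F}
    (hb : ∀ i : Fin p, bas i = x ^ (i : ℕ)) (hp : p.Prime)
    (hx : x ^ p = x + algebraMap F L D) (hD : v.Is D (-b)) (hb0 : 0 < b)
    (hpb : ¬ (p : ℤ) ∣ b) :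
    ∃ w : DVal L, (∀ c m, v.Is c m → w.Is (algebraMap F L c) (p * m)) ∧ w.Is x (-b) ∧
      (∀ y m, w.Ge y m → ∀ i : Fin p, w.Ge (algebraMap F L (bas.repr y i) * x ^ (i : ℕ)) m) ∧
      (∀ y m, w.Is y m → ∃ (i : ℕ) (c : F), i < p ∧ c ≠ 0 ∧ m = p * v.v c - i * b ∧
        w.Ge (y - algebraMap F L c * x ^ i) (m + 1)) := by
  classical
  have hp0 := hp.pos
  have hex : ∀ y : L, y ≠ 0 → ∃ m, LdA v bas x b y m := fun y hy => exists_ldA hb hp hpb hy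
  let f : L → ℤ := fun y => if h : y ≠ 0 then Classical.choose (hex y h) else 0
  have hf : ∀ y, y ≠ 0 → LdA v bas x b y (f y) := by
    intro y hy
    simp only [f, dif_pos hy]
    exact Classical.choose_spec (hex y hy)
  have hfu : ∀ y m, LdA v bas x b y m → f y = m := fun y m h =>
    (hf y (h.ne_zero hb hp0)).unique hb hp0 h
  have hge : ∀ y m, (y = 0 ∨ m ≤ f y) ↔ GeA v bas b y m := by
    intro y m
    constructor
    · rintro (rfl | h)
      · exact geA_zero m
      · by_cases hy : y = 0
        · rw [hy]; exact geA_zero m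
        · exact ((hf y hy).geA hb hp0).mono h
    · intro h
      by_cases hy : y = 0
      · exact Or.inl hy
      · right
        by_contra hlt
        push Not at hlt
        exact (hf y hy).not_geA hb hp0 hlt h
  have hmono : ∀ (c : F) (i : ℕ), c ≠ 0 → i < p →
      LdA v bas x b (algebraMap F L c * x ^ i) (p * v.v c - i * b) := by
    intro c i hc hi
    refine ⟨i, c, hi, hc, rfl, ?_⟩
    rw [sub_self]; exact geA_zero _
  have hone : f 1 = 0 := by
    apply hfu
    have := hmono 1 0 one_ne_zero hp0
    simpa [v.v_one] using this
  have hmul : ∀ y z : L, y ≠ 0 → z ≠ 0 → f (y * z) = f y + f z := by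
    intro y z hy hz
    exact hfu _ _ ((hf y hy).mul hb hp.one_lt hx hD hb0 (hf z hz))
  have hadd : ∀ y z : L, y ≠ 0 → z ≠ 0 → y + z ≠ 0 → min (f y) (f z) ≤ f (y + z) := by
    intro y z hy hz hyz
    refine ((hge _ _).mpr ?_).resolve_left hyz
    exact ((hge _ _).mp (Or.inr (min_le_left _ _))).add hp0
      ((hge _ _).mp (Or.inr (min_le_right _ _)))
  have hunif : ∃ π : L, π ≠ 0 ∧ f π = 1 := by
    have hcop : IsCoprime (p : ℤ) b :=
      (Prime.coprime_iff_not_dvd (Nat.prime_iff_prime_int.mp hp)).mpr hpb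
    obtain ⟨s, t, hst⟩ := hcop
    -- choose exponent i = (-t) mod p
    have hp' : (0 : ℤ) < p := by exact_mod_cast hp0
    have hi0 := Int.emod_nonneg (-t) hp'.ne'
    have hi1 := Int.emod_lt_of_pos (-t) hp'
    obtain ⟨i, hi⟩ := Int.eq_ofNat_of_zero_le hi0
    have hdiv := Int.emod_add_mul_ediv (-t) p
    obtain ⟨c, hc⟩ := v.exists_is (s - (-t / p) * b)
    have hl := hmono c i hc.1 (by omega)
    refine ⟨_, hl.ne_zero hb hp0, ?_⟩
    rw [hfu _ _ hl, hc.2]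
    have : (i : ℤ) = -t - p * (-t / p) := by rw [← hi]; linarith
    rw [this]
    linear_combination hst
  refine ⟨⟨f, hone, hmul, hadd, hunif⟩, ?_, ?_, ?_, ?_⟩
  · intro c m hc
    have := hmono c 0 hc.1 hp0
    simp only [pow_zero, mul_one] at this
    refine ⟨this.ne_zero hb hp0, ?_⟩
    show f _ = _
    rw [hfu _ _ this, hc.2]; simp
  · have := hmono 1 1 one_ne_zero hp.one_lt
    simp only [map_one, one_mul, pow_one, v.v_one] at this
    refine ⟨this.ne_zero hb hp0, ?_⟩
    show f _ = _
    rw [hfu _ _ this]; simp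
  · intro y m h i
    refine (hge _ _).mpr (geA_monomial_lt hb i i.2 fun hc => ?_)
    exact (hge _ _).mp h i hc
  · intro y m h
    obtain ⟨i, c, hi, hc, hm, hr⟩ := hf y h.1
    have hfm : f y = m := h.2
    rw [hfm] at hm hr
    exact ⟨i, c, hi, hc, hm, (hge _ _).mpr hr⟩

section CharP

variable {K : Type*} [Field K] {p : ℕ} [Fact p.Prime] [CharP K p] {v : DVal K}

theorem is_zmod_cast (c : ZMod p) (hc : c ≠ 0) : v.Is (ZMod.castHom (dvd_refl p) K c) 0 := by
  have h1 : c ^ (p - 1) = 1 := ZMod.pow_card_sub_one_eq_one hc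
  have h2 : (ZMod.castHom (dvd_refl p) K c) ^ (p - 1) = 1 := by rw [← map_pow, h1, map_one]
  have h0 : ZMod.castHom (dvd_refl p) K c ≠ 0 := by
    rwa [Ne, map_eq_zero_iff _ (ZMod.castHom (dvd_refl p) K).injective]
  have h3 := ((DVal.is_self (v := v) h0).pow (p - 1))
  rw [h2] at h3
  have h4 := h3.unique DVal.is_one
  have hp2 := (Fact.out : p.Prime).two_le
  refine ⟨h0, ?_⟩
  rcases mul_eq_zero.mp h4 with h5 | h5
  · exfalso; have : p - 1 = 0 := by exact_mod_cast h5
    omega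
  · exact h5

theorem ge_zmod_cast (c : ZMod p) : v.Ge (ZMod.castHom (dvd_refl p) K c) 0 := by
  by_cases hc : c = 0
  · left; rw [hc, map_zero]
  · exact (is_zmod_cast c hc).ge

theorem zmod_cast_pow (c : ZMod p) :
    (ZMod.castHom (dvd_refl p) K c) ^ p = ZMod.castHom (dvd_refl p) K c := by
  rw [← map_pow, ZMod.pow_card]

theorem is_natCast (k : ℕ) (hk : ¬ p ∣ k) : v.Is (k : K) 0 := by
  have : (ZMod.castHom (dvd_refl p) K) (k : ZMod p) = (k : K) := map_natCast _ _
  rw [← this]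
  apply is_zmod_cast
  rwa [Ne, ZMod.natCast_eq_zero_iff]

theorem ge_natCast (k : ℕ) : v.Ge (k : K) 0 := by
  induction k with
  | zero => left; simp
  | succ k ih => push_cast; exact ih.add DVal.is_one.ge

theorem pow_sub_lin {y z : K} {s t : ℤ} (hy : v.Is y s) (hz : v.Ge z t) (hst : s < t) (k : ℕ) :
    v.Ge ((y + z) ^ (k + 1) - y ^ (k + 1) - (k + 1 : ℕ) * y ^ k * z) (k * s + t + 1) := by
  induction k with
  | zero => left; simp
  | succ k ih =>
    have e : (y + z) ^ (k + 1 + 1) - y ^ (k + 1 + 1) - (k + 1 + 1 : ℕ) * y ^ (k + 1) * z =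
        (y + z) * ((y + z) ^ (k + 1) - y ^ (k + 1) - (k + 1 : ℕ) * y ^ k * z)
        + (k + 1 : ℕ) * (y ^ k * (z * z)) := by
      push_cast; ring
    rw [e]
    have h1 : v.Ge (y + z) s := hy.ge.add (hz.mono hst.le)
    refine ((h1.mul ih).mono ?_).add
      (((ge_natCast (k + 1)).mul ((hy.ge.pow k).mul (hz.mul hz))).mono ?_)
    · push_cast; linarith
    · push_cast; linarith

theorem pow_sub_ge {y z : K} {s t : ℤ} (hy : v.Is y s) (hz : v.Ge z t) (hst : s < t) (i : ℕ) :
    v.Ge ((y + z) ^ i - y ^ i) ((i - 1) * s + t) := by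
  cases i with
  | zero => left; simp
  | succ k =>
    have h1 := (pow_sub_lin hy hz hst k).mono
      (show ((k + 1 : ℕ) - 1 : ℤ) * s + t ≤ _ by push_cast; linarith)
    have h2 : v.Ge ((k + 1 : ℕ) * y ^ k * z) (((k + 1 : ℕ) - 1 : ℤ) * s + t) :=
      (((ge_natCast (k + 1)).mul (hy.ge.pow k)).mul hz).mono (by push_cast; linarith)
    have := h1.add h2
    rwa [sub_add_cancel] at this

theorem pow_sub_is {y z : K} {s t : ℤ} (hy : v.Is y s) (hz : v.Is z t) (hst : s < t) (i : ℕ)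
    (hi : ¬ p ∣ i) : v.Is ((y + z) ^ i - y ^ i) ((i - 1) * s + t) := by
  cases i with
  | zero => simp at hi
  | succ k =>
    have h1 := pow_sub_lin hy hz.ge hst k
    have h2 : v.Is ((k + 1 : ℕ) * y ^ k * z) (k * s + t) :=
      (((is_natCast (k + 1) hi).mul (hy.pow k)).mul hz).congr (by ring)
    have := h2.add_ge h1
    rw [add_sub_cancel] at this
    exact this.congr (by push_cast; ring)

theorem perf_pow (hperf : ∀ c, v.Is c 0 → ∃ e, v.Is e 0 ∧ v.Ge (c - e ^ p) 1) {c : K} {m : ℤ}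
    (hc : v.Is c (p * m)) : ∃ e, v.Is e m ∧ v.Ge (c - e ^ p) (p * m + 1) := by
  obtain ⟨t, ht⟩ := v.exists_is m
  have htp := ht.pow p
  obtain ⟨e, he, hr⟩ := hperf (c * (t ^ p)⁻¹) ((hc.mul htp.inv).congr (by ring))
  refine ⟨e * t, (he.mul ht).congr (by ring), ?_⟩
  have := (hr.mul htp.ge).mono (show (p : ℤ) * m + 1 ≤ _ by linarith)
  rwa [sub_mul, mul_assoc, inv_mul_cancel₀ htp.1, mul_one, ← mul_pow] at this

end CharP

theorem exists_exponent {p : ℕ} (hp : p.Prime) {b : ℤ} (hpb : ¬ (p : ℤ) ∣ b) (a : ℤ) :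
    ∃ (i : ℕ) (s : ℤ), i < p ∧ p * s - i * b = a := by
  have hcop : IsCoprime (p : ℤ) b :=
    (Prime.coprime_iff_not_dvd (Nat.prime_iff_prime_int.mp hp)).mpr hpb
  obtain ⟨s, t, hst⟩ := hcop
  have hp' : (0 : ℤ) < p := by exact_mod_cast hp.pos
  have hi0 := Int.emod_nonneg (-(t * a)) hp'.ne'
  have hi1 := Int.emod_lt_of_pos (-(t * a)) hp'
  obtain ⟨i, hi⟩ := Int.eq_ofNat_of_zero_le hi0
  have hdiv := Int.emod_add_mul_ediv (-(t * a)) p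
  refine ⟨i, s * a - (-(t * a) / p) * b, by omega, ?_⟩
  have : (i : ℤ) = -(t * a) - p * (-(t * a) / p) := by rw [← hi]; linarith
  rw [this]
  linear_combination a * hst

section Step

variable {F : Type*} [Field F] {L : Type*} [Field L] [Algebra F L] {p : ℕ} [Fact p.Prime]
  [CharP F p] [CharP L p] {v : DVal F} {w : DVal L} {b : ℤ} {x : L} {D : F}

theorem ge_map (hw : ∀ c m, v.Is c m → w.Is (algebraMap F L c) (p * m)) {c : F} {m : ℤ}
    (h : v.Ge c m) : w.Ge (algebraMap F L c) (p * m) := by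
  by_cases hc : c = 0
  · left; rw [hc, map_zero]
  · have h1 := h.resolve_left hc
    refine (hw c _ (DVal.is_self hc)).ge.mono ?_
    have : (0 : ℤ) ≤ p := by positivity
    nlinarith

theorem red_one (hw : ∀ c m, v.Is c m → w.Is (algebraMap F L c) (p * m))
    (hx : x ^ p = x + algebraMap F L D) (hD : v.Is D (-b)) (hb0 : 0 < b) (hwx : w.Is x (-b))
    (hpb : ¬ (p : ℤ) ∣ b)
    (hperf : ∀ c, v.Is c 0 → ∃ e, v.Is e 0 ∧ v.Ge (c - e ^ p) 1)
    {A : F} {a : ℤ} (hA : v.Is A (-a)) :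
    ∃ (A' : F) (y R : L), v.Ge A' (-a + 1) ∧ w.Ge y (-a) ∧
      algebraMap F L A = algebraMap F L A' + y ^ p + R ∧
      w.Ge R (-(p * a) + (p - 1) * b) ∧ (¬ (p : ℤ) ∣ a → w.Is R (-(p * a) + (p - 1) * b)) := by
  have hp : p.Prime := Fact.out
  obtain ⟨i, s, hi, hs⟩ := exists_exponent hp hpb (-a)
  have hDi := hD.pow i
  have hq : v.Is (A * (D ^ i)⁻¹) (p * s) := (hA.mul hDi.inv).congr (by linarith)
  obtain ⟨e, he, hr⟩ := perf_pow hperf hq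
  have hep := hw e s he
  have hxp := hwx.pow p
  have hxi := hwx.pow i
  have hst : (p : ℤ) * -b < -b := by
    have : (2 : ℤ) ≤ p := by exact_mod_cast hp.two_le
    nlinarith
  refine ⟨A - e ^ p * D ^ i, algebraMap F L e * x ^ i,
    (algebraMap F L e) ^ p * ((x ^ p + -x) ^ i - (x ^ p) ^ i), ?_, ?_, ?_, ?_, ?_⟩
  · have := (hr.mul hDi.ge).mono (show -a + 1 ≤ _ by linarith)
    rwa [sub_mul, mul_assoc, inv_mul_cancel₀ hDi.1, mul_one] at this
  · exact (hep.mul hxi).ge.mono (by linarith)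
  · have hx' : x ^ p + -x = algebraMap F L D := by rw [hx]; ring
    rw [hx']
    simp only [map_sub, map_mul, map_pow]
    ring
  · refine ((hep.pow p).ge.mul (pow_sub_ge hxp hwx.neg.ge hst i)).mono ?_
    have : (a : ℤ) = i * b - p * s := by linarith
    rw [this]; ring_nf; rfl
  · intro ha
    have hi0 : ¬ p ∣ i := by
      intro hd
      apply ha
      have : (p : ℤ) ∣ i := by exact_mod_cast hd
      have e1 : a = i * b - p * s := by linarith
      rw [e1]
      exact dvd_sub (this.mul_right _) (dvd_mul_right _ _)
    refine ((hep.pow p).mul (pow_sub_is hxp hwx.neg hst i hi0)).congr ?_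
    have : (a : ℤ) = i * b - p * s := by linarith
    rw [this]; ring

theorem red_ge (hw : ∀ c m, v.Is c m → w.Is (algebraMap F L c) (p * m))
    (hx : x ^ p = x + algebraMap F L D) (hD : v.Is D (-b)) (hb0 : 0 < b) (hwx : w.Is x (-b))
    (hpb : ¬ (p : ℤ) ∣ b)
    (hperf : ∀ c, v.Is c 0 → ∃ e, v.Is e 0 ∧ v.Ge (c - e ^ p) 1) (T : ℤ) (k : ℕ) :
    ∀ (A : F), v.Ge A (-k) → (k : ℤ) < T → (p : ℤ) * k - (p - 1) * b < T →
      ∃ y : L, w.Ge (algebraMap F L A + y ^ p - y) (-T + 1) := by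
  have hp : p.Prime := Fact.out
  induction k with
  | zero =>
    intro A hA hT _
    refine ⟨0, ?_⟩
    rw [zero_pow hp.ne_zero, add_zero, sub_zero]
    exact (ge_map hw hA).mono (by push_cast at hT ⊢; linarith)
  | succ k ih =>
    intro A hA hT hT'
    have hT1 : (k : ℤ) < T := by push_cast at hT; linarith
    have hT2 : (p : ℤ) * k - (p - 1) * b < T := by
      have : (0 : ℤ) ≤ p := by positivity
      push_cast at hT'; linarith
    by_cases hA' : v.Ge A (-k)
    · exact ih A hA' hT1 hT2
    have hAi : v.Is A (-((k + 1 : ℕ) : ℤ)) := by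
      apply DVal.is_of_ge hA
      intro h; apply hA'; exact h.mono (by push_cast; linarith)
    obtain ⟨A', y, R, h1, h2, h3, h4, -⟩ := red_one hw hx hD hb0 hwx hpb hperf hAi
    obtain ⟨y', hy'⟩ := ih A' (h1.mono (by push_cast; linarith)) hT1 hT2
    refine ⟨y' - y, ?_⟩
    have e : algebraMap F L A + (y' - y) ^ p - (y' - y) =
        (algebraMap F L A' + y' ^ p - y') + y + R := by
      rw [sub_pow_char, h3]; ring
    rw [e]
    exact (hy'.add (h2.mono (by linarith))).add (h4.mono (by linarith))

theorem red_is (hw : ∀ c m, v.Is c m → w.Is (algebraMap F L c) (p * m))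
    (hx : x ^ p = x + algebraMap F L D) (hD : v.Is D (-b)) (hb0 : 0 < b) (hwx : w.Is x (-b))
    (hpb : ¬ (p : ℤ) ∣ b)
    (hperf : ∀ c, v.Is c 0 → ∃ e, v.Is e 0 ∧ v.Ge (c - e ^ p) 1)
    {A : F} {a : ℤ} (hA : v.Is A (-a)) (hpa : ¬ (p : ℤ) ∣ a) (hab : b < a) :
    ∃ y : L, w.Is (algebraMap F L A + y ^ p - y) (-(p * a - (p - 1) * b)) := by
  have hp : p.Prime := Fact.out
  have hp2 : (2 : ℤ) ≤ p := by exact_mod_cast hp.two_le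
  obtain ⟨A', y, R, h1, h2, h3, -, h4⟩ := red_one hw hx hD hb0 hwx hpb hperf hA
  obtain ⟨k, hk⟩ := Int.eq_ofNat_of_zero_le (show 0 ≤ a - 1 by omega)
  have haT : a < p * a - (p - 1) * b := by nlinarith
  obtain ⟨y', hy'⟩ := red_ge hw hx hD hb0 hwx hpb hperf (p * a - (p - 1) * b) k A'
    (h1.mono (by omega)) (by omega) (by rw [← hk]; linarith)
  refine ⟨y' - y, ?_⟩
  have e : algebraMap F L A + (y' - y) ^ p - (y' - y) =
      R + ((algebraMap F L A' + y' ^ p - y') + y) := by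
    rw [sub_pow_char, h3]; ring
  rw [e]
  exact ((h4 hpa).congr (by ring)).add_ge (hy'.add (h2.mono (by linarith)))

theorem ram_step {bas : Module.Basis (Fin p) F L} (hb : ∀ i : Fin p, bas i = x ^ (i : ℕ))
    (hw : ∀ c m, v.Is c m → w.Is (algebraMap F L c) (p * m)) (hwx : w.Is x (-b))
    (hcoord : ∀ y m, w.Ge y m →
      ∀ i : Fin p, w.Ge (algebraMap F L (bas.repr y i) * x ^ (i : ℕ)) m)
    (hlead : ∀ y m, w.Is y m → ∃ (i : ℕ) (c : F), i < p ∧ c ≠ 0 ∧ m = p * v.v c - i * b ∧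
        w.Ge (y - algebraMap F L c * x ^ i) (m + 1))
    (σ : L →+* L) {r : ℤ} (hr : 0 < r)
    (hσF : ∀ c m, v.Is c m → w.Ge (σ (algebraMap F L c) - algebraMap F L c) (p * m + r + 1))
    (hσx : w.Is (σ x - x) (-b + r)) :
    (∀ y m, w.Ge y m → w.Ge (σ y - y) (m + r)) ∧
    (∀ y m, w.Is y m → ¬ (p : ℤ) ∣ m → w.Is (σ y - y) (m + r)) := by
  have hp : p.Prime := Fact.out
  have hσx' : σ x = x + (σ x - x) := by ring
  have hσi : w.Is (σ x) (-b) := by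
    rw [hσx']; exact hwx.add_ge (hσx.ge.mono (by omega))
  have e : ∀ (c : F) (i : ℕ), σ (algebraMap F L c * x ^ i) - algebraMap F L c * x ^ i =
      algebraMap F L c * ((x + (σ x - x)) ^ i - x ^ i)
        + (σ (algebraMap F L c) - algebraMap F L c) * (σ x) ^ i := by
    intro c i
    rw [← hσx', map_mul, map_pow]; ring
  have mono : ∀ (c : F) (i : ℕ), c ≠ 0 →
      w.Ge (σ (algebraMap F L c * x ^ i) - algebraMap F L c * x ^ i)
        (p * v.v c - i * b + r) := by
    intro c i hc
    have hci := DVal.is_self (v := v) hc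
    rw [e]
    refine (((hw _ _ hci).ge.mul (pow_sub_ge hwx hσx.ge (by omega) i)).mono ?_).add
      (((hσF _ _ hci).mul (hσi.pow i).ge).mono ?_)
    · linarith
    · linarith
  have part1 : ∀ y m, w.Ge y m → w.Ge (σ y - y) (m + r) := by
    intro y m hy
    have e2 : σ y - y = ∑ i : Fin p, (σ (algebraMap F L (bas.repr y i) * x ^ (i : ℕ))
        - algebraMap F L (bas.repr y i) * x ^ (i : ℕ)) := by
      rw [Finset.sum_sub_distrib, ← map_sum, ← sum_monomial hb y]
    rw [e2]
    refine DVal.Ge.sum _ _ fun i _ => ?_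
    by_cases hc : bas.repr y i = 0
    · left; simp [hc]
    · refine (mono _ i hc).mono ?_
      have h1 := hcoord y m hy i
      have h2 := (hw _ _ (DVal.is_self hc)).mul (hwx.pow i)
      have h3 : ¬ (p * v.v (bas.repr y i) + (i : ℕ) * -b < m) := fun h => h2.not_ge h h1
      linarith
  refine ⟨part1, fun y m hy hm => ?_⟩
  obtain ⟨i, c, hi, hc, hmi, hrem⟩ := hlead y m hy
  have hi0 : ¬ p ∣ i := by
    intro hd
    apply hm
    have : (p : ℤ) ∣ i := by exact_mod_cast hd
    rw [hmi]
    exact dvd_sub (dvd_mul_right _ _) (this.mul_right _)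
  have hci := DVal.is_self (v := v) hc
  have e3 : σ y - y = (algebraMap F L c * ((x + (σ x - x)) ^ i - x ^ i)
        + (σ (algebraMap F L c) - algebraMap F L c) * (σ x) ^ i)
        + (σ (y - algebraMap F L c * x ^ i) - (y - algebraMap F L c * x ^ i)) := by
    rw [← e, map_sub]; ring
  rw [e3]
  have h1 : w.Is (algebraMap F L c * ((x + (σ x - x)) ^ i - x ^ i)) (m + r) :=
    ((hw _ _ hci).mul (pow_sub_is hwx hσx (by omega) i hi0)).congr (by rw [hmi]; ring)
  refine (h1.add_ge ?_).add_ge ?_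
  · exact ((hσF _ _ hci).mul (hσi.pow i).ge).mono (by rw [hmi]; linarith)
  · exact (part1 _ _ hrem).mono (by linarith)

end Step

section GroupPart

variable {G : Type*} [Group G]

theorem exists_char {p n : ℕ} [Fact p.Prime] [Finite G] (hG : Nat.card G = p ^ n)
    (N N' : Subgroup G) [N.Normal] [N'.Normal] (hle : N' ≤ N)
    (hcard : Nat.card N = p * Nat.card N') :
    ∃ (f χ : G → ZMod p), (∀ h, ∀ z ∈ N, f (h * z) = f h + χ z) ∧
      (∀ z ∈ N, ∀ z' ∈ N, χ (z * z') = χ z + χ z') ∧ (∀ z ∈ N, χ z = 0 ↔ z ∈ N') ∧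
      (∀ g, ∀ z ∈ N, χ (g⁻¹ * z * g) = χ z) ∧ (∀ c, ∃ z ∈ N, χ z = c) := by
  classical
  have hp : p.Prime := Fact.out
  have hq : Nat.card (N ⧸ N'.subgroupOf N) = p := by
    have h1 := Subgroup.card_eq_card_quotient_mul_card_subgroup (N'.subgroupOf N)
    have h2 : Nat.card (N'.subgroupOf N) = Nat.card N' :=
      Nat.card_congr (Subgroup.subgroupOfEquivOfLe hle).toEquiv
    rw [h2, hcard] at h1
    exact (Nat.eq_of_mul_eq_mul_right Nat.card_pos h1).symm
  have hz : Nat.card (Multiplicative (ZMod p)) = p := by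
    rw [Nat.card_congr Multiplicative.toAdd, Nat.card_zmod]
  let e : (N ⧸ N'.subgroupOf N) ≃* Multiplicative (ZMod p) :=
    mulEquivOfPrimeCardEq (p := p) hq hz
  let χ : G → ZMod p := fun z => if h : z ∈ N then
    (e (QuotientGroup.mk (⟨z, h⟩ : N))).toAdd else 0
  have hχ : ∀ z (h : z ∈ N), χ z = (e (QuotientGroup.mk (⟨z, h⟩ : N))).toAdd := by
    intro z h; simp only [χ, dif_pos h]
  have hmul : ∀ z ∈ N, ∀ z' ∈ N, χ (z * z') = χ z + χ z' := by
    intro z h z' h'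
    rw [hχ z h, hχ z' h', hχ _ (N.mul_mem h h'), ← toAdd_mul, ← map_mul]
    rfl
  have hker : ∀ z ∈ N, χ z = 0 ↔ z ∈ N' := by
    intro z h
    rw [hχ z h, toAdd_eq_zero, map_eq_one_iff _ e.injective, QuotientGroup.eq_one_iff,
      Subgroup.mem_subgroupOf]
  have hsurj : ∀ c, ∃ z ∈ N, χ z = c := by
    intro c
    obtain ⟨q, hq⟩ := e.surjective (Multiplicative.ofAdd c)
    obtain ⟨z, rfl⟩ := QuotientGroup.mk_surjective q
    refine ⟨z, z.2, ?_⟩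
    rw [hχ _ z.2]
    rw [hq]; rfl
  have hone : χ 1 = 0 := (hker 1 N.one_mem).mpr N'.one_mem
  have hpow : ∀ z ∈ N, ∀ k : ℕ, χ (z ^ k) = k * χ z := by
    intro z hz k
    induction k with
    | zero => simp [hone]
    | succ k ih =>
      rw [pow_succ, hmul _ (N.pow_mem hz k) _ hz, ih]; push_cast; ring
  have hconjN : ∀ g, ∀ z ∈ N, g⁻¹ * z * g ∈ N := by
    intro g z hz
    have := Subgroup.Normal.conj_mem (H := N) inferInstance z hz g⁻¹
    simpa using this
  have hconjN' : ∀ g, ∀ z ∈ N', g⁻¹ * z * g ∈ N' := by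
    intro g z hz
    have := Subgroup.Normal.conj_mem (H := N') inferInstance z hz g⁻¹
    simpa using this
  obtain ⟨z0, hz0, hz01⟩ := hsurj 1
  have hlam : ∀ g, ∀ z ∈ N, χ (g⁻¹ * z * g) = χ (g⁻¹ * z0 * g) * χ z := by
    intro g z hz
    set k := (χ z).val with hk
    have hkz : (k : ZMod p) = χ z := by rw [hk]; simp
    set m := (z0 ^ k)⁻¹ * z with hm
    have hzk := N.pow_mem hz0 k
    have hmN : m ∈ N := N.mul_mem (N.inv_mem hzk) hz
    have hzm : z = z0 ^ k * m := by rw [hm]; group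
    have hm' : m ∈ N' := by
      rw [← hker m hmN]
      have h1 := hmul _ hzk _ hmN
      rw [← hzm, hpow _ hz0, hz01, mul_one, hkz] at h1
      simpa using h1
    have h2 : g⁻¹ * z * g = (g⁻¹ * z0 * g) ^ k * (g⁻¹ * m * g) := by
      have h3 : (g⁻¹ * z0 * g) ^ k = g⁻¹ * z0 ^ k * g := by
        have := conj_pow (a := g⁻¹) (b := z0) (i := k)
        simpa using this
      rw [h3, hzm]; group
    rw [h2, hmul _ (N.pow_mem (hconjN g z0 hz0) k) _ (hconjN g m hmN),
      (hker _ (hconjN g m hmN)).mpr (hconjN' g m hm'), add_zero,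
      hpow _ (hconjN g z0 hz0), hkz, mul_comm]
  have hlpow : ∀ g (k : ℕ), χ ((g ^ k)⁻¹ * z0 * g ^ k) = χ (g⁻¹ * z0 * g) ^ k := by
    intro g k
    induction k with
    | zero => simp [hz01]
    | succ k ih =>
      have : (g ^ (k + 1))⁻¹ * z0 * g ^ (k + 1) = g⁻¹ * ((g ^ k)⁻¹ * z0 * g ^ k) * g := by
        rw [pow_succ]; group
      rw [this, hlam g _ (hconjN _ _ hz0), ih, pow_succ, mul_comm]
  have hl1 : ∀ g, χ (g⁻¹ * z0 * g) = 1 := by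
    intro g
    have h1 := hlpow g (p ^ n)
    rw [ZMod.pow_card_pow] at h1
    have h2 : g ^ (p ^ n) = 1 := by rw [← hG]; exact pow_card_eq_one'
    rw [h2] at h1
    rw [← h1]; simp [hz01]
  have hinv : ∀ g, ∀ z ∈ N, χ (g⁻¹ * z * g) = χ z := by
    intro g z hz; rw [hlam g z hz, hl1, one_mul]
  have hout : ∀ h : G, ((QuotientGroup.mk h : G ⧸ N).out)⁻¹ * h ∈ N := by
    intro h
    rw [← QuotientGroup.eq, QuotientGroup.out_eq']
  refine ⟨fun h => χ (((QuotientGroup.mk h : G ⧸ N).out)⁻¹ * h), χ, ?_, hmul, hker, hinv, hsurj⟩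
  intro h z hz
  have : (QuotientGroup.mk (h * z) : G ⧸ N) = QuotientGroup.mk h :=
    QuotientGroup.mk_mul_of_mem h hz
  simp only [this]
  rw [← mul_assoc, hmul _ (hout h) _ hz]

/-- Sum over representatives of `G ⧸ N`. -/
noncomputable def qsum [Finite G] (N : Subgroup G) {L : Type*} [AddCommMonoid L] (F : G → L) : L :=
  letI := Fintype.ofFinite (G ⧸ N)
  ∑ q : G ⧸ N, F q.out

variable [Finite G] {N : Subgroup G}

theorem out_mem (N : Subgroup G) (h : G) : ((QuotientGroup.mk h : G ⧸ N).out)⁻¹ * h ∈ N := by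
  rw [← QuotientGroup.eq, QuotientGroup.out_eq']

theorem rinv_out {L : Type*} {F : G → L} (hF : ∀ h, ∀ z ∈ N, F (h * z) = F h) (h : G) :
    F ((QuotientGroup.mk h : G ⧸ N).out) = F h := by
  have := hF ((QuotientGroup.mk h : G ⧸ N).out) _ (out_mem N h)
  rw [mul_inv_cancel_left] at this
  exact this.symm

theorem qsum_translate {L : Type*} [AddCommMonoid L] {F : G → L}
    (hF : ∀ h, ∀ z ∈ N, F (h * z) = F h) (g : G) :
    qsum N (fun h => F (g * h)) = qsum N F := by
  unfold qsum
  let _ := Fintype.ofFinite (G ⧸ N)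
  rw [← Equiv.sum_comp (MulAction.toPerm g : Equiv.Perm (G ⧸ N)) (fun q : G ⧸ N => F q.out)]
  refine Finset.sum_congr rfl fun q _ => ?_
  rw [MulAction.toPerm_apply]
  have : g • q = QuotientGroup.mk (g * q.out) := by
    conv_lhs => rw [← QuotientGroup.out_eq' q]
    rfl
  rw [this, rinv_out hF]

theorem qsum_fibre {L : Type*} [AddCommMonoid L] {N' : Subgroup G} (hle : N' ≤ N)
    {p : ℕ} [Fact p.Prime] {χ : G → ZMod p}
    (hmul : ∀ z ∈ N, ∀ z' ∈ N, χ (z * z') = χ z + χ z') (hker : ∀ z ∈ N, χ z = 0 ↔ z ∈ N')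
    {s : ZMod p → G} (hs : ∀ c, s c ∈ N) (hsc : ∀ c, χ (s c) = c)
    {F : G → L} (hF : ∀ h, ∀ z ∈ N', F (h * z) = F h) :
    qsum N' F = qsum N (fun h => ∑ c : ZMod p, F (h * s c)) := by
  unfold qsum
  let _ := Fintype.ofFinite (G ⧸ N)
  let _ := Fintype.ofFinite (G ⧸ N')
  have hinv : ∀ z ∈ N, χ z⁻¹ = - χ z := by
    intro z hz
    have h1 := hmul _ (N.inv_mem hz) _ hz
    rw [inv_mul_cancel, (hker 1 N.one_mem).mpr N'.one_mem] at h1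
    exact (neg_eq_of_add_eq_zero_left h1.symm).symm
  rw [← Fintype.sum_prod_type' (f := fun (q : G ⧸ N) (c : ZMod p) => F (q.out * s c))]
  symm
  refine Fintype.sum_bijective
    (fun a : (G ⧸ N) × ZMod p => (QuotientGroup.mk (a.1.out * s a.2) : G ⧸ N')) ⟨?_, ?_⟩ _ _ ?_
  · rintro ⟨q, c⟩ ⟨q', c'⟩ h
    have h1 : (q.out * s c)⁻¹ * (q'.out * s c') ∈ N' := QuotientGroup.eq.mp h
    have h2 : (QuotientGroup.mk (q.out * s c) : G ⧸ N) = QuotientGroup.mk (q'.out * s c') :=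
      QuotientGroup.eq.mpr (hle h1)
    rw [QuotientGroup.mk_mul_of_mem _ (hs c), QuotientGroup.mk_mul_of_mem _ (hs c'),
      QuotientGroup.out_eq', QuotientGroup.out_eq'] at h2
    subst h2
    have h3 : (s c)⁻¹ * s c' ∈ N' := by
      have : (q.out * s c)⁻¹ * (q.out * s c') = (s c)⁻¹ * s c' := by group
      rwa [this] at h1
    have h4 := (hker _ (hle h3)).mpr h3
    rw [hmul _ (N.inv_mem (hs c)) _ (hs c'), hinv _ (hs c), hsc, hsc] at h4
    have : c = c' := by linear_combination -h4
    rw [this]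
  · intro q
    obtain ⟨h, rfl⟩ := QuotientGroup.mk_surjective q
    have ho := out_mem N h
    refine ⟨(QuotientGroup.mk h, χ ((QuotientGroup.mk h : G ⧸ N).out⁻¹ * h)), ?_⟩
    apply QuotientGroup.eq.mpr
    simp only
    set o := (QuotientGroup.mk h : G ⧸ N).out
    have hc := hs (χ (o⁻¹ * h))
    have : (o * s (χ (o⁻¹ * h)))⁻¹ * h = (s (χ (o⁻¹ * h)))⁻¹ * (o⁻¹ * h) := by group
    rw [this, ← hker _ (N.mul_mem (N.inv_mem hc) ho), hmul _ (N.inv_mem hc) _ ho, hinv _ hc, hsc]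
    ring
  · rintro ⟨q, c⟩
    exact (rinv_out hF _).symm

theorem map_qsum {L L' : Type*} [AddCommMonoid L] [AddCommMonoid L'] (φ : L →+ L') (F : G → L) :
    φ (qsum N F) = qsum N (fun h => φ (F h)) := by
  unfold qsum; rw [map_sum]

theorem qsum_add {L : Type*} [AddCommMonoid L] (F F' : G → L) :
    qsum N (fun h => F h + F' h) = qsum N F + qsum N F' := by
  unfold qsum; rw [Finset.sum_add_distrib]

theorem qsum_mul {L : Type*} [CommRing L] (c : L) (F : G → L) :
    qsum N (fun h => c * F h) = c * qsum N F := by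
  unfold qsum; rw [Finset.mul_sum]

theorem qsum_ge {L : Type*} [Field L] {w : DVal L} {F : G → L} {m : ℤ} (h : ∀ g, w.Ge (F g) m) :
    w.Ge (qsum N F) m := by
  unfold qsum; exact DVal.Ge.sum _ _ fun i _ => h _

end GroupPart

theorem sum_zmod_pow {L : Type*} [Field L] {p : ℕ} [Fact p.Prime] [CharP L p] (x : L) :
    ∑ c : ZMod p, (x + ZMod.castHom (dvd_refl p) L c) ^ (p - 1) = -1 := by
  have hp : p.Prime := Fact.out
  have hp2 := hp.two_le
  simp_rw [add_pow]
  rw [Finset.sum_comm]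
  have key : ∀ m ∈ Finset.range (p - 1 + 1), ∑ c : ZMod p,
      x ^ m * (ZMod.castHom (dvd_refl p) L c) ^ (p - 1 - m) * ((p - 1).choose m : L) =
      if m = 0 then -1 else 0 := by
    intro m hm
    have h1 : ∑ c : ZMod p,
      x ^ m * (ZMod.castHom (dvd_refl p) L c) ^ (p - 1 - m) * ((p - 1).choose m : L) =
      x ^ m * ZMod.castHom (dvd_refl p) L (∑ c : ZMod p, c ^ (p - 1 - m))
        * ((p - 1).choose m : L) := by
      rw [map_sum, Finset.mul_sum, Finset.sum_mul]
      simp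
    rw [h1]
    split_ifs with h0
    · subst h0
      have h2 : ∑ c : ZMod p, c ^ (p - 1 - 0) = -1 := by
        have h3 : ∀ c : ZMod p, c ^ (p - 1 - 0) = 1 - if c = 0 then 1 else 0 := by
          intro c
          split_ifs with hc
          · rw [hc, Nat.sub_zero, zero_pow (by omega)]; ring
          · rw [Nat.sub_zero, ZMod.pow_card_sub_one_eq_one hc]; ring
        simp_rw [h3]
        rw [Finset.sum_sub_distrib]
        simp
      rw [h2]; simp
    · rw [FiniteField.sum_pow_lt_card_sub_one (ZMod p) _ (by rw [ZMod.card]; omega)]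
      simp
  rw [Finset.sum_congr rfl key]
  simp

theorem exists_cocycle {K : Type*} [Field K] {L : Type*} [Field L] [Algebra K L]
    {G : Type*} [Group G] [Finite G] {p : ℕ} [Fact p.Prime] [CharP L p]
    {N : Subgroup G} [N.Normal] (ρ : G →* (L ≃ₐ[K] L)) (hρN : ∀ z ∈ N, ρ z = 1)
    {f χ : G → ZMod p} (hf : ∀ h, ∀ z ∈ N, f (h * z) = f h + χ z)
    (hmul : ∀ z ∈ N, ∀ z' ∈ N, χ (z * z') = χ z + χ z')
    (hinv : ∀ g, ∀ z ∈ N, χ (g⁻¹ * z * g) = χ z)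
    {θ : L} (hθ : qsum N (fun h => ρ h θ) = 1) {w : DVal L} {t : ℤ} (ht : 0 ≤ t)
    (hθv : w.Ge θ (-t)) (hρv : ∀ g y m, w.Ge y m → w.Ge (ρ g y) m) :
    ∃ (a : G → L) (D : L), (∀ g h, a (g * h) = a g + ρ g (a h)) ∧
      (∀ z ∈ N, a z = ZMod.castHom (dvd_refl p) L (-χ z)) ∧
      (∀ g, a g ^ p - a g = ρ g D - D) ∧ w.Ge D (-((p + 1) * t)) := by
  have hp : p.Prime := Fact.out
  set ι := ZMod.castHom (dvd_refl p) L with hι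
  have hρι : ∀ g c, ρ g (ι c) = ι c := by
    intro g c
    have : ((ρ g : L ≃ₐ[K] L) : L →+* L).comp ι = ι := Subsingleton.elim _ _
    exact congrArg (fun φ : ZMod p →+* L => φ c) this
  have hρr : ∀ h, ∀ z ∈ N, ρ (h * z) = ρ h := by
    intro h z hz; rw [map_mul, hρN z hz, mul_one]
  have hχ1 : χ 1 = 0 := by
    have := hmul 1 N.one_mem 1 N.one_mem
    simpa using this
  have hχinv : ∀ z ∈ N, χ z⁻¹ = - χ z := by
    intro z hz
    have h1 := hmul _ (N.inv_mem hz) _ hz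
    rw [inv_mul_cancel, hχ1] at h1
    exact (neg_eq_of_add_eq_zero_left h1.symm).symm
  let a : G → L := fun g => qsum N (fun h => ι (f (g⁻¹ * h) - f h) * ρ h θ)
  have ha : ∀ g h, a (g * h) = a g + ρ g (a h) := by
    intro g g'
    have h1 : ρ g (a g') = qsum N (fun h => ι (f (g'⁻¹ * h) - f h) * ρ (g * h) θ) := by
      have := map_qsum (N := N) ((ρ g : L ≃ₐ[K] L) : L →+ L)
        (fun h => ι (f (g'⁻¹ * h) - f h) * ρ h θ)
      refine this.trans ?_
      congr 1
      funext h
      show ρ g (ι _ * ρ h θ) = _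
      rw [map_mul, hρι, map_mul]; rfl
    have h2 := qsum_translate (N := N)
      (F := fun h => ι (f (g'⁻¹ * (g⁻¹ * h)) - f (g⁻¹ * h)) * ρ h θ) (by
        intro h z hz
        rw [hρr h z hz, ← mul_assoc, ← mul_assoc, hf _ z hz, ← mul_assoc, hf _ z hz, mul_assoc g'⁻¹]
        congr 2; ring) g
    simp only [inv_mul_cancel_left] at h2
    rw [h1, h2, ← qsum_add]
    show qsum N _ = _
    congr 1
    funext h
    rw [← add_mul, ← map_add, mul_inv_rev, mul_assoc]
    congr 2; ring
  have haN : ∀ z ∈ N, a z = ι (-χ z) := by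
    intro z hz
    have h1 : a z = qsum N (fun h => ι (-χ z) * ρ h θ) := by
      show qsum N _ = _
      congr 1
      funext h
      congr 2
      have h2 : z⁻¹ * h = h * (h⁻¹ * z⁻¹ * h) := by group
      have hm : h⁻¹ * z⁻¹ * h ∈ N := by
        have := Subgroup.Normal.conj_mem (H := N) inferInstance z⁻¹ (N.inv_mem hz) h⁻¹
        simpa using this
      have h3 : f (z⁻¹ * h) = f h + χ (z⁻¹) := by
        rw [h2, hf _ _ hm, hinv h _ (N.inv_mem hz)]
      rw [h3, hχinv z hz]; ring
    rw [h1, qsum_mul, hθ, mul_one]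
  have hav : ∀ g, w.Ge (a g) (-t) := by
    intro g
    refine qsum_ge fun h => ?_
    exact ((ge_zmod_cast _).mul (hρv h _ _ hθv)).mono (by omega)
  let β : G → L := fun g => a g ^ p - a g
  have hβ : ∀ g h, β (g * h) = β g + ρ g (β h) := by
    intro g h
    simp only [β]
    rw [ha, add_pow_char, map_sub, map_pow]; ring
  have hβN : ∀ z ∈ N, β z = 0 := by
    intro z hz
    simp only [β]
    rw [haN z hz, hι, zmod_cast_pow, sub_self]
  have hβv : ∀ g, w.Ge (β g) (-(p * t)) := by
    intro g
    have hp2 : (1 : ℤ) ≤ p := by exact_mod_cast hp.one_lt.le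
    refine (((hav g).pow p).mono (by linarith)).sub ((hav g).mono (by nlinarith))
  refine ⟨a, - qsum N (fun h => β h * ρ h θ), ha, haN, ?_, ?_⟩
  · intro g
    have h1 : ρ g (qsum N (fun h => β h * ρ h θ)) =
        qsum N (fun h => (β (g * h) - β g) * ρ (g * h) θ) := by
      have := map_qsum (N := N) ((ρ g : L ≃ₐ[K] L) : L →+ L) (fun h => β h * ρ h θ)
      refine this.trans ?_
      congr 1
      funext h
      show ρ g (β h * ρ h θ) = _
      rw [hβ, map_mul, map_mul]
      simp
    have h2 := qsum_translate (N := N) (F := fun h => (β h - β g) * ρ h θ) (by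
        intro h z hz
        rw [hρr h z hz, hβ, hβN z hz, map_zero, add_zero]) g
    have h3 : qsum N (fun h => β h * ρ h θ) =
        qsum N (fun h => (β h - β g) * ρ h θ) + β g := by
      have h5 := qsum_add (N := N) (fun h => (β h - β g) * ρ h θ) (fun h => β g * ρ h θ)
      rw [qsum_mul (β g), hθ, mul_one] at h5
      rw [← h5]
      congr 1
      funext h
      ring
    rw [map_neg, h1, h2, h3]
    show β g = _
    ring
  · refine (qsum_ge fun h => ?_ : w.Ge _ _).neg
    exact ((hβv h).mul (hρv h _ _ hθv)).mono (by linarith)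

open Polynomial in
theorem exists_AS_ext {K : Type u} [Field K] {F : Type u} [Field F] [Algebra K F]
    {G : Type*} [Group G] {p : ℕ} [Fact p.Prime] [CharP F p] {v : DVal F}
    (ρ : G →* (F ≃ₐ[K] F)) {a : G → F} {D : F} {b : ℤ}
    (ha : ∀ g h, a (g * h) = a g + ρ g (a h)) (hD : ∀ g, a g ^ p - a g = ρ g D - D)
    (hDv : v.Is D (-b)) (hb0 : 0 < b) (hpb : ¬ (p : ℤ) ∣ b) :
    ∃ (L : Type u) (_ : Field L) (_ : Algebra F L) (_ : Algebra K L) (_ : IsScalarTower K F L)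
      (x : L) (bas : Module.Basis (Fin p) F L) (ρ' : G →* (L ≃ₐ[K] L)),
      (∀ i : Fin p, bas i = x ^ (i : ℕ)) ∧ x ^ p = x + algebraMap F L D ∧
      (∀ g c, ρ' g (algebraMap F L c) = algebraMap F L (ρ g c)) ∧
      (∀ g, ρ' g x = x + algebraMap F L (a g)) := by
  have hp : p.Prime := Fact.out
  let f : F[X] := X ^ p - X - C D
  have hdeg : (X + C D : F[X]).degree < p := by
    rw [degree_X_add_C]; exact_mod_cast hp.one_lt
  have hfe : f = X ^ p - (X + C D) := by simp only [f]; ring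
  have hmon : f.Monic := by rw [hfe]; exact monic_X_pow_sub hdeg
  have hnat : f.natDegree = p := by
    rw [hfe]
    apply natDegree_eq_of_degree_eq_some
    rw [degree_sub_eq_left_of_degree_lt (by rwa [degree_X_pow]), degree_X_pow]
  let bas0 : Module.Basis (Fin p) F (AdjoinRoot f) :=
    (AdjoinRoot.powerBasis' hmon).basis.reindex (finCongr hnat)
  have hb : ∀ i : Fin p, bas0 i = (AdjoinRoot.root f) ^ (i : ℕ) := by
    intro i
    simp only [bas0, Module.Basis.reindex_apply]
    rw [PowerBasis.basis_eq_pow]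
    rfl
  have hx : (AdjoinRoot.root f) ^ p = AdjoinRoot.root f + algebraMap F (AdjoinRoot f) D := by
    have h := AdjoinRoot.eval₂_root f
    have h2 : ∀ {S : Type u} [CommRing S] (i : F →+* S) (r : S),
        f.eval₂ i r = r ^ p - r - i D := by
      intro S _ i r
      simp only [f, eval₂_sub, eval₂_pow, eval₂_X, eval₂_C]
    rw [h2] at h
    have h3 : algebraMap F (AdjoinRoot f) D = AdjoinRoot.of f D := rfl
    rw [h3]
    linear_combination h
  have hnz : NoZeroDivisors (AdjoinRoot f) := noZeroDivisors_ext hb hp hx hDv hb0 hpb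
  have hnt : Nontrivial (AdjoinRoot f) := by
    apply AdjoinRoot.nontrivial
    rw [degree_eq_natDegree hmon.ne_zero, hnat]
    exact_mod_cast hp.ne_zero
  have hdom : IsDomain (AdjoinRoot f) := NoZeroDivisors.to_isDomain _
  have hirr : Irreducible f := by
    have h1 : (Ideal.span {f}).IsPrime := (Ideal.Quotient.isDomain_iff_prime _).mp hdom
    exact ((Ideal.span_singleton_prime hmon.ne_zero).mp h1).irreducible
  haveI : Fact (Irreducible f) := ⟨hirr⟩
  haveI : CharP (AdjoinRoot f) p :=
    charP_of_injective_algebraMap (algebraMap F (AdjoinRoot f)).injective p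
  let j : F →+* AdjoinRoot f := algebraMap F (AdjoinRoot f)
  have hev : ∀ g, f.eval₂ (j.comp ((ρ g : F ≃ₐ[K] F) : F →+* F)) (AdjoinRoot.root f + j (a g)) = 0 := by
    intro g
    simp only [f, eval₂_sub, eval₂_pow, eval₂_X, eval₂_C]
    rw [add_pow_char, hx, ← map_pow]
    have h1 : j (a g ^ p) = j (a g) + j (ρ g D) - j D := by
      rw [← map_add, ← map_sub]
      congr 1
      linear_combination hD g
    rw [h1]
    show AdjoinRoot.root f + j D + (j (a g) + j (ρ g D) - j D) - (AdjoinRoot.root f + j (a g)) - j (ρ g D) = 0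
    ring
  let φ : G → (AdjoinRoot f →+* AdjoinRoot f) := fun g =>
    AdjoinRoot.lift (j.comp ((ρ g : F ≃ₐ[K] F) : F →+* F)) (AdjoinRoot.root f + j (a g)) (hev g)
  have hφc : ∀ g c, φ g (j c) = j (ρ g c) := fun g c => AdjoinRoot.lift_of (hev g)
  have hφx : ∀ g, φ g (AdjoinRoot.root f) = AdjoinRoot.root f + j (a g) :=
    fun g => AdjoinRoot.lift_root (hev g)
  have hjK : ∀ k : K, algebraMap K (AdjoinRoot f) k = j (algebraMap K F k) := fun k =>
    IsScalarTower.algebraMap_apply K F (AdjoinRoot f) k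
  have hext : ∀ s t : AdjoinRoot f →+* AdjoinRoot f, (∀ c, s (j c) = t (j c)) →
      s (AdjoinRoot.root f) = t (AdjoinRoot.root f) → s = t := by
    intro s t h1 h2
    ext y
    · exact h1 y
    · exact h2
  have ha1 : a 1 = 0 := by
    have := ha 1 1
    simpa using this
  let Φ : G →* (AdjoinRoot f →ₐ[K] AdjoinRoot f) :=
    { toFun := fun g => { φ g with
        commutes' := by
          intro k
          show φ g (algebraMap K (AdjoinRoot f) k) = algebraMap K (AdjoinRoot f) k
          rw [hjK, hφc, AlgEquiv.commutes] }
      map_one' := by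
        have : φ 1 = RingHom.id _ := by
          apply hext
          · intro c; rw [hφc, map_one]; rfl
          · rw [hφx, ha1, map_zero, add_zero]; rfl
        refine AlgHom.ext fun y => ?_
        exact congrArg (fun s : AdjoinRoot f →+* AdjoinRoot f => s y) this
      map_mul' := by
        intro g h
        have : φ (g * h) = (φ g).comp (φ h) := by
          apply hext
          · intro c
            rw [hφc, RingHom.comp_apply, hφc, hφc, map_mul]; rfl
          · rw [hφx, RingHom.comp_apply, hφx, map_add, hφx, hφc, ha, map_add, add_assoc]
        refine AlgHom.ext fun y => ?_
        exact congrArg (fun s : AdjoinRoot f →+* AdjoinRoot f => s y) this }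
  let ρ' : G →* (AdjoinRoot f ≃ₐ[K] AdjoinRoot f) :=
    (AlgEquiv.algHomUnitsEquiv K (AdjoinRoot f)).toMonoidHom.comp Φ.toHomUnits
  exact ⟨AdjoinRoot f, inferInstance, inferInstance, inferInstance, inferInstance,
    AdjoinRoot.root f, bas0, ρ', hb, hx, hφc, hφx⟩


/-- The inductive data: a totally ramified tower of height `j`. -/
structure IsStage (p : ℕ) {K : Type u} [Field K] (vK : DVal K) {G : Type*} [Group G] [Finite G]
    (Gser : ℕ → Subgroup G) (u b : ℕ → ℤ) (j : ℕ) {L : Type u} [Field L] [Algebra K L]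
    (v : DVal L) (ρ : G →* (L ≃ₐ[K] L)) : Prop where
  ker : ∀ g, ρ g = 1 ↔ g ∈ Gser j
  fin : Module.finrank K L = p ^ j
  totram : ∀ c m, vK.Is c m → v.Is (algebraMap K L c) ((p : ℤ) ^ j * m)
  ram : ∀ k, k < j → ∀ g, g ∈ Gser k → g ∉ Gser (k + 1) →
    (∀ y m, v.Ge y m → v.Ge (ρ g y - y) (m + b (k + 1))) ∧
    (∀ y m, v.Is y m → ¬ (p : ℤ) ∣ m → v.Is (ρ g y - y) (m + b (k + 1)))
  perf : ∀ c, v.Is c 0 → ∃ e, v.Is e 0 ∧ v.Ge (c - e ^ p) 1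
  red : ∀ κ a, vK.Is κ (-a) → ¬ (p : ℤ) ∣ a → u j < a →
    ∃ y, v.Is (algebraMap K L κ + y ^ p - y) (-(b j + (p : ℤ) ^ j * (a - u j)))
  tr : ∃ θ, qsum (Gser j) (fun h => ρ h θ) = 1 ∧ v.Ge θ (-(p * b j))

theorem exists_layer {G : Type*} [Group G] {Gser : ℕ → Subgroup G} (htop : Gser 0 = ⊤)
    (j : ℕ) (g : G) (hg : g ∉ Gser j) : ∃ k, k < j ∧ g ∈ Gser k ∧ g ∉ Gser (k + 1) := by
  induction j with
  | zero => rw [htop] at hg; exact absurd (Subgroup.mem_top g) hg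
  | succ j ih =>
    by_cases h : g ∈ Gser j
    · exact ⟨j, Nat.lt_succ_self j, h, hg⟩
    · obtain ⟨k, hk, h1, h2⟩ := ih h
      exact ⟨k, by omega, h1, h2⟩

section StageLemmas

variable {p : ℕ} {K : Type u} [Field K] {vK : DVal K} {G : Type*} [Group G] [Finite G]
    {Gser : ℕ → Subgroup G} {u b : ℕ → ℤ} {j : ℕ} {L : Type u} [Field L] [Algebra K L]
    {v : DVal L} {ρ : G →* (L ≃ₐ[K] L)}

theorem IsStage.sub_ge (hS : IsStage p vK Gser u b j v ρ) (htop : Gser 0 = ⊤)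
    (hb : ∀ k, k < j → 0 < b (k + 1)) (g : G) {y : L} {m : ℤ} (h : v.Ge y m) :
    v.Ge (ρ g y - y) (m + 1) := by
  by_cases hg : g ∈ Gser j
  · rw [(hS.ker g).mpr hg]
    simpa using DVal.ge_zero (v := v) (m + 1)
  · obtain ⟨k, hk, h1, h2⟩ := exists_layer htop j g hg
    exact ((hS.ram k hk g h1 h2).1 y m h).mono (by linarith [hb k hk])

theorem IsStage.map_ge (hS : IsStage p vK Gser u b j v ρ) (htop : Gser 0 = ⊤)
    (hb : ∀ k, k < j → 0 < b (k + 1)) (g : G) {y : L} {m : ℤ} (h : v.Ge y m) :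
    v.Ge (ρ g y) m := by
  have : ρ g y = y + (ρ g y - y) := by ring
  rw [this]
  exact h.add ((hS.sub_ge htop hb g h).mono (by omega))

theorem IsStage.map_is (hS : IsStage p vK Gser u b j v ρ) (htop : Gser 0 = ⊤)
    (hb : ∀ k, k < j → 0 < b (k + 1)) (g : G) {y : L} {m : ℤ} (h : v.Is y m) :
    v.Is (ρ g y) m := by
  have : ρ g y = y + (ρ g y - y) := by ring
  rw [this]
  exact h.add_ge (hS.sub_ge htop hb g h.ge)

end StageLemmas

theorem stage_zero {p : ℕ} (hp : p.Prime) {K : Type u} [Field K] {vK : DVal K}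
    (hperf : vK.PerfectResidue p)
    {G : Type*} [Group G] [Finite G] {Gser : ℕ → Subgroup G} (htop : Gser 0 = ⊤)
    {u b : ℕ → ℤ} (hu : u 0 = 0) (hb : b 0 = 0) :
    IsStage p vK Gser u b 0 vK (1 : G →* (K ≃ₐ[K] K)) where
  ker g := by simp [htop]
  fin := by simp
  totram c m h := by simpa using h
  ram k hk := by omega
  perf c hc := by
    obtain ⟨y, h1, h2⟩ := hperf c hc.ge
    refine ⟨y, DVal.is_of_ge h1 fun h => ?_, h2⟩
    have h3 : vK.Ge (y ^ p) 1 := (h.pow p).mono (by have := hp.two_le; push_cast; omega)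
    have h4 : c = (c - y ^ p) + y ^ p := by ring
    have h5 : vK.Ge c 1 := by rw [h4]; exact DVal.Ge.add h2 h3
    exact hc.not_ge (by norm_num) h5
  red κ a hκ _ _ := ⟨0, by simpa [hu, hb, zero_pow hp.ne_zero] using hκ⟩
  tr := by
    refine ⟨1, ?_, by simpa [hb] using (DVal.is_one (v := vK)).ge⟩
    rw [htop]
    unfold qsum
    simp [← Nat.card_eq_fintype_card]


theorem as_val {K : Type*} [Field K] {p : ℕ} (hp : p.Prime) {v : DVal K} {a d : K} {s : ℤ}
    (h : a ^ p - a = d) (hd : v.Is d (-s)) (hs : 0 < s) : ∃ m, v.Is a (-m) ∧ p * m = s := by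
  have hp2 : (2 : ℤ) ≤ p := by exact_mod_cast hp.two_le
  have ha : a ≠ 0 := by
    rintro rfl
    rw [zero_pow hp.ne_zero, sub_zero] at h
    exact hd.1 h.symm
  have h1 := DVal.is_self (v := v) ha
  have hk : v.v a < 0 := by
    by_contra hk
    push Not at hk
    have h2 : v.Ge a 0 := Or.inr hk
    have h3 : v.Ge d 0 := by
      rw [← h]
      exact ((h2.pow p).mono (by simp)).sub h2
    exact hd.not_ge (by omega) h3
  have h2 : v.Is d (p * v.v a) := by
    rw [← h, sub_eq_add_neg]
    exact (h1.pow p).add_ge (h1.neg.ge.mono (by nlinarith))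
  exact ⟨-v.v a, h1.congr (by ring), by have := h2.unique hd; linarith⟩

theorem stage_succ {p n : ℕ} [Fact p.Prime] {K : Type u} [Field K] [CharP K p] {vK : DVal K}
    {G : Type*} [Group G] [Finite G] (hG : Nat.card G = p ^ n)
    {Gser : ℕ → Subgroup G} [∀ j, (Gser j).Normal] (htop : Gser 0 = ⊤)
    {u b : ℕ → ℤ} {j : ℕ} (hle : Gser (j + 1) ≤ Gser j)
    (hcard : Nat.card (Gser j) = p * Nat.card (Gser (j + 1)))
    (hbs : b (j + 1) = b j + (p : ℤ) ^ j * (u (j + 1) - u j)) (hu : u j < u (j + 1))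
    (hpu : ¬ (p : ℤ) ∣ u (j + 1))
    (hb0 : 0 ≤ b j) (hbpos : ∀ k, k ≤ j → 0 < b (k + 1))
    (hmono : ∀ k, k < j → b (k + 1) < b (j + 1))
    (hgrow : (p + 1) * (p * b j) < b (j + 1))
    (hpsi : ∀ a, ¬ (p : ℤ) ∣ a → ¬ (p : ℤ) ∣ b j + (p : ℤ) ^ j * (a - u j))
    {F : Type u} [Field F] [Algebra K F] {v : DVal F} {ρ : G →* (F ≃ₐ[K] F)}
    (hS : IsStage p vK Gser u b j v ρ) :
    ∃ (L : Type u) (_ : Field L) (_ : Algebra K L) (w : DVal L) (ρ' : G →* (L ≃ₐ[K] L)),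
      IsStage p vK Gser u b (j + 1) w ρ' := by
  have hp : p.Prime := Fact.out
  have hp2 : (2 : ℤ) ≤ p := by exact_mod_cast hp.two_le
  have : CharP F p := charP_of_injective_algebraMap (algebraMap K F).injective p
  have hbp : 0 < b (j + 1) := hbpos j le_rfl
  have hpb : ¬ (p : ℤ) ∣ b (j + 1) := by rw [hbs]; exact hpsi _ hpu
  have hbl : ∀ k, k < j → 0 < b (k + 1) := fun k hk => hbpos k hk.le
  obtain ⟨f, χ, hf, hmul, hker, hinv, hsurj⟩ := exists_char hG (Gser j) (Gser (j + 1)) hle hcard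
  obtain ⟨θ, hθ, hθv⟩ := hS.tr
  obtain ⟨a0, D0, ha0, ha0N, hD0, hD0v⟩ := exists_cocycle ρ (fun z hz => (hS.ker z).mpr hz)
    hf hmul hinv hθ (by positivity) hθv (fun g y m h => hS.map_ge htop hbl g h)
  obtain ⟨κ, hκ⟩ := vK.exists_is (-(u (j + 1)))
  obtain ⟨y, hy⟩ := hS.red κ _ hκ hpu hu
  rw [← hbs] at hy
  obtain ⟨D, hDdef⟩ : ∃ D, D = (algebraMap K F κ + y ^ p - y) + D0 := ⟨_, rfl⟩
  obtain ⟨a, hadef⟩ : ∃ a : G → F, ∀ g, a g = a0 g + (ρ g y - y) := ⟨_, fun g => rfl⟩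
  have hDv : v.Is D (-(b (j + 1))) := by
    rw [hDdef]; exact hy.add_ge (hD0v.mono (by linarith))
  have ha : ∀ g h, a (g * h) = a g + ρ g (a h) := by
    intro g h
    rw [hadef, hadef, hadef, ha0, map_mul, map_add, map_sub, AlgEquiv.mul_apply]
    ring
  have haN : ∀ z ∈ Gser j, a z = ZMod.castHom (dvd_refl p) F (-χ z) := by
    intro z hz
    rw [hadef, ha0N z hz, (hS.ker z).mpr hz]
    simp
  have hD : ∀ g, a g ^ p - a g = ρ g D - D := by
    intro g
    rw [hadef, hDdef, add_pow_char, sub_pow_char, map_add, map_sub, map_add, map_pow,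
      AlgEquiv.commutes]
    linear_combination hD0 g
  obtain ⟨L, _, _, _, _, x, bas, ρ', hb, hx, hρF, hρx⟩ := exists_AS_ext ρ ha hD hDv hbp hpb
  have : CharP L p := charP_of_injective_algebraMap (algebraMap F L).injective p
  obtain ⟨w, hw, hwx, hcoord, hlead⟩ := exists_ext_val hb hp hx hDv hbp hpb
  refine ⟨L, inferInstance, inferInstance, w, ρ', ?_⟩
  have hker' : ∀ g, g ∈ Gser (j + 1) → ρ' g = 1 := by
    intro g hg
    have h1 : ρ g = 1 := (hS.ker g).mpr (hle hg)
    have h2 : a g = 0 := by rw [haN g (hle hg), (hker g (hle hg)).mpr hg]; simp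
    refine AlgEquiv.ext fun y => ?_
    rw [AlgEquiv.one_apply]
    conv_lhs => rw [sum_monomial hb y]
    conv_rhs => rw [sum_monomial hb y]
    rw [map_sum]
    refine Finset.sum_congr rfl fun i _ => ?_
    rw [map_mul, map_pow, hρF, hρx, h1, h2]
    simp
  refine ⟨?_, ?_, ?_, ?_, ?_, ?_, ?_⟩
  · intro g
    refine ⟨fun h => ?_, hker' g⟩
    have h1 : g ∈ Gser j := by
      rw [← hS.ker]
      refine AlgEquiv.ext fun c => (algebraMap F L).injective ?_
      rw [← hρF, h]; rfl
    have h2 : a g = 0 := by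
      have := hρx g
      rw [h, AlgEquiv.one_apply, left_eq_add, map_eq_zero] at this
      exact this
    rw [haN g h1, map_eq_zero, neg_eq_zero] at h2
    exact (hker g h1).mp h2
  · rw [← Module.finrank_mul_finrank K F L, hS.fin, Module.finrank_eq_card_basis bas,
      Fintype.card_fin, pow_succ]
  · intro c m hc
    rw [IsScalarTower.algebraMap_apply K F L]
    exact (hw _ _ (hS.totram c m hc)).congr (by ring)
  · intro k hk g hg hg'
    refine ram_step hb hw hwx hcoord hlead ((ρ' g : L ≃ₐ[K] L) : L →+* L) (r := b (k + 1))
      (hbpos k (by omega)) ?_ ?_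
    · intro c m hc
      show w.Ge (ρ' g (algebraMap F L c) - algebraMap F L c) _
      rw [hρF, ← map_sub]
      rcases Nat.lt_succ_iff_lt_or_eq.mp hk with hk | rfl
      · refine (ge_map hw ((hS.ram k hk g hg hg').1 c m hc.ge)).mono ?_
        have := hbpos k hk.le
        nlinarith
      · rw [(hS.ker g).mpr hg]
        simpa using DVal.ge_zero (v := w) _
    · show w.Is (ρ' g x - x) _
      rw [hρx, add_sub_cancel_left]
      rcases Nat.lt_succ_iff_lt_or_eq.mp hk with hk | rfl
      · have h1 := (hS.ram k hk g hg hg').2 D _ hDv (by rwa [dvd_neg])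
        rw [← hD] at h1
        obtain ⟨m, hm, hpm⟩ := as_val hp (s := b (j + 1) - b (k + 1)) rfl
          (h1.congr (by ring)) (by linarith [hmono k hk])
        exact (hw _ _ hm).congr (by linarith)
      · rw [haN g hg]
        have h1 : -χ g ≠ 0 := by rw [neg_ne_zero, Ne, hker g hg]; exact hg'
        exact (hw _ _ (is_zmod_cast (v := v) _ h1)).congr (by ring)
  · intro c hc
    obtain ⟨i, d, hi, hd, hm, hr⟩ := hlead c 0 hc
    have hi0 : i = 0 := by
      refine distinct_aux hp hpb hi hp.pos (s := v.v d) (t := 0) ?_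
      rw [← hm]; simp
    subst hi0
    have hd0 : v.Is d 0 := ⟨hd, by
      have : (p : ℤ) * v.v d = 0 := by simpa using hm.symm
      rcases mul_eq_zero.mp this with h | h
      · omega
      · exact h⟩
    obtain ⟨e, he, hde⟩ := hS.perf d hd0
    refine ⟨algebraMap F L e, (hw _ _ he).congr (by ring), ?_⟩
    have h1 : c - algebraMap F L e ^ p =
        (c - algebraMap F L d * x ^ 0) + algebraMap F L (d - e ^ p) := by
      rw [map_sub, map_pow]; ring
    rw [h1]
    exact (hr.mono (by norm_num)).add ((ge_map hw hde).mono (by linarith))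
  · intro κ' c hκ' hpc hc
    have huc : u j < c := by linarith
    obtain ⟨y1, hy1⟩ := hS.red κ' c hκ' hpc huc
    have hpj : (0 : ℤ) < (p : ℤ) ^ j := by positivity
    obtain ⟨y2, hy2⟩ := red_is hw hx hDv hbp hwx hpb hS.perf hy1 (hpsi c hpc)
      (by rw [hbs]; nlinarith)
    refine ⟨algebraMap F L y1 + y2, ?_⟩
    have e : algebraMap K L κ' + (algebraMap F L y1 + y2) ^ p - (algebraMap F L y1 + y2) =
        algebraMap F L (algebraMap K F κ' + y1 ^ p - y1) + y2 ^ p - y2 := by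
      rw [IsScalarTower.algebraMap_apply K F L, add_pow_char, map_sub, map_add, map_pow]
      ring
    rw [e]
    refine hy2.congr ?_
    rw [hbs]; ring
  · choose s hs hsc using hsurj
    refine ⟨algebraMap F L θ * (-(x ^ (p - 1))), ?_, ?_⟩
    · rw [qsum_fibre hle hmul hker hs hsc]
      · have h1 : ∀ h, ∑ c : ZMod p, ρ' (h * s c) (algebraMap F L θ * (-(x ^ (p - 1)))) =
            algebraMap F L (ρ h θ) := by
          intro h
          have h2 : ∀ c, ρ' (h * s c) (algebraMap F L θ * (-(x ^ (p - 1)))) =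
              ρ' h (algebraMap F L θ * (-((x + ZMod.castHom (dvd_refl p) L (-c)) ^ (p - 1)))) := by
            intro c
            rw [map_mul ρ', AlgEquiv.mul_apply]
            congr 1
            rw [map_mul, map_neg, map_pow, hρF, hρx, haN _ (hs c), hsc,
              (hS.ker _).mpr (hs c), AlgEquiv.one_apply]
            have h3 : algebraMap F L (ZMod.castHom (dvd_refl p) F (-c)) =
                ZMod.castHom (dvd_refl p) L (-c) :=
              congrArg (fun φ : ZMod p →+* L => φ (-c))
                (Subsingleton.elim ((algebraMap F L).comp (ZMod.castHom (dvd_refl p) F)) _)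
            rw [h3]
          rw [Finset.sum_congr rfl fun c _ => h2 c, ← map_sum, ← Finset.mul_sum,
            Finset.sum_neg_distrib]
          have h4 := Equiv.sum_comp (Equiv.neg (ZMod p))
            (fun c => (x + ZMod.castHom (dvd_refl p) L c) ^ (p - 1))
          simp only [Equiv.neg_apply] at h4
          rw [h4, sum_zmod_pow, neg_neg, mul_one, hρF]
        simp only [h1]
        rw [← map_one (algebraMap F L), ← hθ]
        exact (map_qsum (algebraMap F L : F →+ L) _).symm
      · intro h z hz
        rw [map_mul ρ', hker' z hz, mul_one]
    · refine ((ge_map hw hθv).mul (hwx.pow (p - 1)).neg.ge).mono ?_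
      have h1 : ((p - 1 : ℕ) : ℤ) = p - 1 := by
        rw [Nat.cast_sub hp.one_lt.le]; simp
      rw [h1]
      nlinarith


section Arith

/-- The lower breaks attached to a sequence of upper breaks. -/
def lbr (p : ℕ) (u : ℕ → ℤ) : ℕ → ℤ
  | 0 => 0
  | k + 1 => lbr p u k + (p : ℤ) ^ k * (u (k + 1) - u k)

variable {p n : ℕ} {u : ℕ → ℤ}

theorem lbr_succ (k : ℕ) : lbr p u (k + 1) = lbr p u k + (p : ℤ) ^ k * (u (k + 1) - u k) := rfl

theorem lbr_lt (hp : p.Prime) (hu : ∀ k, k < n → u k < u (k + 1)) {i k : ℕ} (hik : i < k)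
    (hk : k ≤ n) : lbr p u i < lbr p u k := by
  induction k with
  | zero => omega
  | succ k ih =>
    have hpk : (0 : ℤ) < (p : ℤ) ^ k := by have := hp.pos; positivity
    have h1 : lbr p u k < lbr p u (k + 1) := by
      rw [lbr_succ]; have := hu k (by omega); nlinarith
    rcases Nat.lt_succ_iff_lt_or_eq.mp hik with h | rfl
    · exact (ih h (by omega)).trans h1
    · exact h1

theorem lbr_nonneg (hp : p.Prime) (hu : ∀ k, k < n → u k < u (k + 1)) {k : ℕ} (hk : k ≤ n) :
    0 ≤ lbr p u k := by
  rcases Nat.eq_zero_or_pos k with rfl | h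
  · exact le_rfl
  · exact (lbr_lt hp hu h hk).le

theorem lbr_le (hp : p.Prime) (hu0 : u 0 = 0) (hu : ∀ k, k < n → u k < u (k + 1))
    {k : ℕ} (hk : k ≤ n) : 0 ≤ u k ∧ lbr p u k ≤ (p : ℤ) ^ k * u k := by
  induction k with
  | zero => simp [hu0, lbr]
  | succ k ih =>
    obtain ⟨h1, h2⟩ := ih (by omega)
    have h3 := hu k (by omega)
    have hpk : (0 : ℤ) < (p : ℤ) ^ k := by have := hp.pos; positivity
    have hp2 : (2 : ℤ) ≤ p := by exact_mod_cast hp.two_le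
    refine ⟨by linarith, ?_⟩
    rw [lbr_succ, pow_succ]
    have h4 : (p : ℤ) ^ k * u (k + 1) ≤ (p : ℤ) ^ k * p * u (k + 1) := by
      have : 0 ≤ (p : ℤ) ^ k * u (k + 1) := mul_nonneg hpk.le (by linarith)
      nlinarith
    nlinarith

theorem lbr_psi (hp : p.Prime) (hu0 : u 0 = 0) (hpu : ∀ i, 1 ≤ i → i ≤ n → ¬ (p : ℤ) ∣ u i)
    {k : ℕ} (hk : k ≤ n) (a : ℤ) (ha : ¬ (p : ℤ) ∣ a) :
    ¬ (p : ℤ) ∣ lbr p u k + (p : ℤ) ^ k * (a - u k) := by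
  induction k generalizing a with
  | zero => simpa [hu0, lbr] using ha
  | succ k ih =>
    have h1 := ih (by omega) (u (k + 1)) (hpu _ (by omega) hk)
    rw [← lbr_succ] at h1
    intro h2
    refine h1 ((Int.dvd_add_left ?_).mp h2)
    exact Dvd.dvd.mul_right (dvd_pow_self _ (by omega)) _

theorem lbr_grow (hp : p.Prime) (hu0 : u 0 = 0) (hu : ∀ k, k < n → u k < u (k + 1))
    (hM : ∀ i, 1 ≤ i → i + 1 ≤ n → (1 + p * (p + 1)) * u i < u (i + 1))
    {k : ℕ} (hk : k < n) : ((p : ℤ) + 1) * (p * lbr p u k) < lbr p u (k + 1) := by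
  have hpk : (0 : ℤ) < (p : ℤ) ^ k := by have := hp.pos; positivity
  have hp2 : (2 : ℤ) ≤ p := by exact_mod_cast hp.two_le
  obtain ⟨h1, h2⟩ := lbr_le hp hu0 hu hk.le
  have h3 := lbr_nonneg hp hu hk.le
  have h5 := hu k hk
  have h4 : p * (p + 1) * u k < u (k + 1) - u k := by
    rcases Nat.eq_zero_or_pos k with rfl | h
    · rw [hu0] at h5 ⊢; linarith
    · linarith [hM k h hk]
  have h6 := mul_lt_mul_of_pos_left h4 hpk
  have h7 := mul_le_mul_of_nonneg_left h2 (show (0 : ℤ) ≤ p * (p + 1) by positivity)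
  rw [lbr_succ]
  nlinarith

end Arith

theorem exists_stage {p n : ℕ} [Fact p.Prime] {K : Type u} [Field K] [CharP K p] {vK : DVal K}
    (hperf : vK.PerfectResidue p)
    {G : Type*} [Group G] [Finite G] (hG : Nat.card G = p ^ n)
    {Gser : ℕ → Subgroup G} [∀ j, (Gser j).Normal] (htop : Gser 0 = ⊤)
    (hlt : ∀ j, j < n → Gser (j + 1) < Gser j)
    (hcard : ∀ j, j ≤ n → Nat.card (Gser j) = p ^ (n - j))
    {u : ℕ → ℤ} (hu0 : u 0 = 0) (hu : ∀ k, k < n → u k < u (k + 1))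
    (hpu : ∀ i, 1 ≤ i → i ≤ n → ¬ (p : ℤ) ∣ u i)
    (hM : ∀ i, 1 ≤ i → i + 1 ≤ n → (1 + p * (p + 1)) * u i < u (i + 1))
    {j : ℕ} (hj : j ≤ n) :
    ∃ (L : Type u) (_ : Field L) (_ : Algebra K L) (w : DVal L) (ρ : G →* (L ≃ₐ[K] L)),
      IsStage p vK Gser u (lbr p u) j w ρ := by
  have hp : p.Prime := Fact.out
  induction j with
  | zero => exact ⟨K, inferInstance, inferInstance, vK, 1, stage_zero hp hperf htop hu0 rfl⟩
  | succ j ih =>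
    obtain ⟨F, _, _, v, ρ, hS⟩ := ih (by omega)
    refine stage_succ hG htop (hlt j hj).le ?_ (lbr_succ j) (hu j hj) (hpu _ (by omega) hj)
      (lbr_nonneg hp hu (by omega)) (fun k hk => ?_) (fun k hk => ?_)
      (lbr_grow hp hu0 hu hM hj) (lbr_psi hp hu0 hpu (by omega)) hS
    · rw [hcard j (by omega), hcard (j + 1) hj, ← pow_succ']
      congr 1; omega
    · exact lbr_lt hp hu (i := 0) (by omega) (by omega)
    · exact lbr_lt hp hu (by omega) hj

section Final

variable {p n : ℕ} {K : Type u} [Field K] {vK : DVal K}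
    {G : Type*} [Group G] [Finite G] {Gser : ℕ → Subgroup G} {u b : ℕ → ℤ}
    {L : Type u} [Field L] [Algebra K L] {v : DVal L} {ρ : G →* (L ≃ₐ[K] L)} {π : L}

theorem ramNum_eq (hp : p.Prime) (hS : IsStage p vK Gser u b n v ρ) (htop : Gser 0 = ⊤)
    (hb : ∀ k, k < n → 0 < b (k + 1)) (hπ : v.Is π 1) {k : ℕ} (hk : k < n) {g : G}
    (hg : g ∈ Gser k) (hg' : g ∉ Gser (k + 1)) : ramNum K v π (ρ g) = b (k + 1) := by
  have h1 : inInertia K v (ρ g) := fun x hx => hS.sub_ge htop hb g hx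
  have h2 := (hS.ram k hk g hg hg').2 π 1 hπ (by
    intro h
    have := Int.le_of_dvd one_pos h
    have := hp.two_le
    omega)
  unfold ramNum
  rw [if_pos h1, h2.2]
  ring

theorem gser_anti (hlt : ∀ j, j < n → Gser (j + 1) < Gser j) {i k : ℕ} (hik : i ≤ k)
    (hk : k ≤ n) : Gser k ≤ Gser i := by
  induction k with
  | zero => obtain rfl : i = 0 := by omega
            exact le_rfl
  | succ k ih =>
    rcases Nat.le_succ_iff.mp hik with h | rfl
    · exact (hlt k hk).le.trans (ih h (by omega))
    · exact le_rfl

theorem mem_lowerSet_iff (hp : p.Prime) (hS : IsStage p vK Gser u b n v ρ) (htop : Gser 0 = ⊤)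
    (hlt : ∀ j, j < n → Gser (j + 1) < Gser j)
    (hb : ∀ k, k < n → 0 < b (k + 1)) (hπ : v.Is π 1) {t : ℝ} {i : ℕ} (hi : i ≤ n)
    (h1 : ∀ k, 1 ≤ k → k ≤ i → (b k : ℝ) < t) (h2 : ∀ k, i < k → k ≤ n → t ≤ (b k : ℝ)) (g : G) :
    ρ g ∈ lowerSet K v π t ↔ g ∈ Gser i := by
  by_cases hg : g ∈ Gser n
  · refine ⟨fun _ => gser_anti hlt hi le_rfl hg, fun _ => Or.inl ((hS.ker g).mpr hg)⟩
  · obtain ⟨k, hk, hk1, hk2⟩ := exists_layer htop n g hg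
    have hne : ρ g ≠ 1 := fun h => hg ((hS.ker g).mp h)
    have hr := ramNum_eq hp hS htop hb hπ hk hk1 hk2
    have e1 : ρ g ∈ lowerSet K v π t ↔ t ≤ (b (k + 1) : ℝ) := by
      show (ρ g = 1 ∨ t ≤ (ramNum K v π (ρ g) : ℝ)) ↔ _
      rw [hr]
      exact or_iff_right hne
    rw [e1]
    constructor
    · intro h
      by_contra h3
      have h4 : k + 1 ≤ i := by
        by_contra h5
        exact h3 (gser_anti hlt (by omega) hk.le hk1)
      linarith [h1 (k + 1) (by omega) h4]
    · intro h
      refine h2 _ ?_ hk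
      by_contra h5
      exact hk2 (gser_anti hlt (by omega) hi h)

theorem final_witness (hp : p.Prime) (hG : Nat.card G = p ^ n)
    (htop : Gser 0 = ⊤) (hbot : Gser n = ⊥)
    (hlt : ∀ j, j < n → Gser (j + 1) < Gser j)
    (hcard : ∀ j, j ≤ n → Nat.card (Gser j) = p ^ (n - j))
    (hu0 : u 0 = 0) (hu : ∀ k, k < n → u k < u (k + 1))
    (hS : IsStage p vK Gser u (lbr p u) n v ρ) {u' : ℕ → ℤ} (huu : ∀ i, 1 ≤ i → u i = u' i) :
    Nonempty (RamifiedGWitness p n K vK G Gser u') := by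
  have hb : ∀ k, k < n → 0 < lbr p u (k + 1) := fun k hk =>
    lbr_lt hp hu (i := 0) (by omega) (by omega)
  obtain ⟨π, hπ⟩ := v.exists_is 1
  have hinj : Function.Injective ρ := by
    rw [injective_iff_map_eq_one]
    intro g hg
    rwa [hS.ker, hbot, Subgroup.mem_bot] at hg
  have hpn : 0 < p ^ n := pow_pos hp.pos n
  have hfd : FiniteDimensional K L := Module.finite_of_finrank_pos (by rw [hS.fin]; exact hpn)
  have hle : Nat.card (L ≃ₐ[K] L) ≤ Nat.card G := by
    rw [hG, ← hS.fin, Nat.card_eq_fintype_card]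
    exact AlgEquiv.card_le
  have hbij : Function.Bijective ρ := hinj.bijective_of_nat_card_le hle
  let e : G ≃* (L ≃ₐ[K] L) := MulEquiv.ofBijective ρ hbij
  have hcardL : Nat.card (L ≃ₐ[K] L) = Module.finrank K L := by
    rw [hS.fin, ← hG]; exact (Nat.card_congr e.toEquiv).symm
  have hgal : IsGalois K L := IsGalois.of_card_aut_eq_finrank K L hcardL
  have hblt : ∀ i k, i < k → k ≤ n → (lbr p u i : ℝ) < lbr p u k := fun i k h h' => by
    exact_mod_cast lbr_lt hp hu h h'
  have hble : ∀ i k, i ≤ k → k ≤ n → (lbr p u i : ℝ) ≤ lbr p u k := fun i k h h' => by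
    rcases h.eq_or_lt with rfl | h
    · exact le_rfl
    · exact (hblt i k h h').le
  have hmem : ∀ {t : ℝ} {i : ℕ}, i ≤ n → (∀ k, 1 ≤ k → k ≤ i → (lbr p u k : ℝ) < t) →
      (∀ k, i < k → k ≤ n → t ≤ (lbr p u k : ℝ)) →
      (fun σ => e.symm σ) '' lowerSet K v π t = (Gser i : Set G) := by
    intro t i hi h1 h2
    ext g
    have h3 := mem_lowerSet_iff hp hS htop hlt hb hπ hi h1 h2 g
    rw [SetLike.mem_coe, ← h3]
    constructor
    · rintro ⟨σ, hσ, rfl⟩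
      have : ρ (e.symm σ) = σ := e.apply_symm_apply σ
      show ρ (e.symm σ) ∈ _
      rwa [this]
    · intro h
      exact ⟨ρ g, h, e.symm_apply_apply g⟩
  have hcardlow : ∀ {t : ℝ} {i : ℕ}, i ≤ n → (∀ k, 1 ≤ k → k ≤ i → (lbr p u k : ℝ) < t) →
      (∀ k, i < k → k ≤ n → t ≤ (lbr p u k : ℝ)) →
      Nat.card (lowerSet K v π t) = p ^ (n - i) := by
    intro t i hi h1 h2
    rw [← hcard i hi, ← Nat.card_image_of_injective e.symm.injective (lowerSet K v π t)]
    have h3 := hmem hi h1 h2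
    exact congrArg (fun s : Set G => Nat.card s) h3
  have hp0 : (0 : ℝ) < p := by exact_mod_cast hp.pos
  have hc0 : (Nat.card (lowerSet K v π 0) : ℝ) = (p : ℝ) ^ n := by
    rw [hcardlow (i := 0) (Nat.zero_le n) (fun k h h' => by omega)
      (fun k _ hk => by exact_mod_cast lbr_nonneg hp hu hk)]
    push_cast; rfl
  have hherbeq : ∀ k, k ≤ n → IntervalIntegrable (fun t : ℝ =>
      (Nat.card ↥(lowerSet K v π t) : ℝ) / (Nat.card ↥(lowerSet K v π 0) : ℝ))
        MeasureTheory.volume 0 (lbr p u k) ∧ hherb K v π (lbr p u k) = u k := by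
    intro k
    induction k with
    | zero =>
      intro _
      simp [lbr, hherb, hu0]
    | succ k ih =>
      intro hk
      obtain ⟨h1, h2⟩ := ih (by omega)
      have h3 : (lbr p u k : ℝ) ≤ lbr p u (k + 1) := hble _ _ (by omega) hk
      have h4 : Set.EqOn (fun _ : ℝ => ((p : ℝ) ^ k)⁻¹) (fun t : ℝ =>
          (Nat.card ↥(lowerSet K v π t) : ℝ) / (Nat.card ↥(lowerSet K v π 0) : ℝ))
          (Set.Ioc (lbr p u k : ℝ) (lbr p u (k + 1))) := by
        intro t ht
        show _ = (Nat.card ↥(lowerSet K v π t) : ℝ) / (Nat.card ↥(lowerSet K v π 0) : ℝ)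
        rw [hc0, hcardlow (i := k) (by omega)
          (fun i _ hi => (hble i k hi (by omega)).trans_lt ht.1)
          (fun i hi hi' => ht.2.trans (hble _ _ (by omega) hi'))]
        push_cast
        have : (p : ℝ) ^ n = (p : ℝ) ^ (n - k) * (p : ℝ) ^ k := by
          rw [← pow_add]; congr 1; omega
        rw [this]
        field_simp
      have h5 : IntervalIntegrable (fun t : ℝ =>
          (Nat.card ↥(lowerSet K v π t) : ℝ) / (Nat.card ↥(lowerSet K v π 0) : ℝ))
          MeasureTheory.volume (lbr p u k) (lbr p u (k + 1)) := by
        refine (intervalIntegrable_const (c := ((p : ℝ) ^ k)⁻¹)).congr ?_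
        rw [Set.uIoc_of_le h3]
        exact h4
      refine ⟨h1.trans h5, ?_⟩
      unfold hherb at h2 ⊢
      rw [← intervalIntegral.integral_add_adjacent_intervals h1 h5, h2,
        intervalIntegral.integral_of_le h3,
        ← MeasureTheory.setIntegral_congr_fun measurableSet_Ioc h4,
        ← intervalIntegral.integral_of_le h3, intervalIntegral.integral_const, lbr_succ]
      push_cast
      rw [smul_eq_mul]
      field_simp
      ring
  refine ⟨{ L := L, vL := v, πL := π, μ := e.symm, galois := hgal, findim := hfd, unif := hπ,
            inv := ?_, totram := ?_, upper := ?_, ramsub₁ := ?_, ramsub₂ := ?_ }⟩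
  · intro σ x
    obtain ⟨g, rfl⟩ := hbij.2 σ
    by_cases hx : x = 0
    · rw [hx, map_zero]
    · exact (hS.map_is htop hb g (DVal.is_self hx)).2
  · intro x hx
    exact (hS.totram x _ (DVal.is_self hx)).2
  · intro x
    constructor
    · rintro ⟨c, ⟨σ, hσ, rfl⟩, rfl⟩
      obtain ⟨g, rfl⟩ := hbij.2 σ
      have hg : g ∉ Gser n := fun h => hσ ((hS.ker g).mpr h)
      obtain ⟨k, hk, hk1, hk2⟩ := exists_layer htop n g hg
      refine ⟨k + 1, by omega, hk, ?_⟩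
      rw [ramNum_eq hp hS htop hb hπ hk hk1 hk2, (hherbeq (k + 1) hk).2, huu _ (by omega)]
    · rintro ⟨i, hi1, hi2, rfl⟩
      obtain ⟨k, rfl⟩ : ∃ k, i = k + 1 := ⟨i - 1, by omega⟩
      obtain ⟨g, hg, hg'⟩ := SetLike.exists_of_lt (hlt k hi2)
      refine ⟨lbr p u (k + 1), ⟨ρ g, ?_, ?_⟩, ?_⟩
      · intro h
        exact hg' (gser_anti hlt hi2 le_rfl ((hS.ker g).mp h))
      · rw [ramNum_eq hp hS htop hb hπ hi2 hg hg']
      · rw [(hherbeq (k + 1) hi2).2, huu _ hi1]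
  · intro t
    classical
    let i := Nat.findGreatest (fun k => (lbr p u k : ℝ) < t) n
    refine ⟨i, Nat.findGreatest_le n, hmem (Nat.findGreatest_le n) ?_ ?_⟩
    · intro k hk1 hk2
      have h1 : (lbr p u i : ℝ) < t :=
        Nat.findGreatest_of_ne_zero (P := fun k => (lbr p u k : ℝ) < t) (n := n) rfl (by omega)
      exact (hble k i hk2 (Nat.findGreatest_le n)).trans_lt h1
    · intro k hk1 hk2
      exact not_lt.mp (Nat.findGreatest_is_greatest hk1 hk2)
  · intro i hi
    rcases hi.eq_or_lt with rfl | hi'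
    · refine ⟨lbr p u i + 1, hmem hi ?_ ?_⟩
      · intro k _ hk
        linarith [hble k i hk le_rfl]
      · intro k h1 h2; omega
    · refine ⟨lbr p u (i + 1), hmem hi ?_ ?_⟩
      · intro k _ hk
        exact hblt _ _ (by omega) hi'
      · intro k h1 h2
        exact hble _ _ h1 h2

end Final

theorem growth_aux (p n : ℕ) (hp : p.Prime)
    (G : Type*) [Group G] [Finite G] (hG : Nat.card G = p ^ n)
    (Gser : ℕ → Subgroup G) [∀ j, (Gser j).Normal]
    (htop : Gser 0 = ⊤) (hbot : Gser n = ⊥)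
    (hlt : ∀ j, j < n → Gser (j + 1) < Gser j)
    (hcard : ∀ j, j ≤ n → Nat.card (Gser j) = p ^ (n - j))
    (K : Type u) [Field K] [CharP K p] (vK : DVal K) (hperf : vK.PerfectResidue p)
    (u : ℕ → ℤ) (hpos : ∀ i, 1 ≤ i → i ≤ n → 0 < u i)
    (hpu : ∀ i, 1 ≤ i → i ≤ n → ¬ (p : ℤ) ∣ u i)
    (hM : ∀ i, 1 ≤ i → i + 1 ≤ n → ((1 + p * (p + 1) : ℤ) : ℝ) * (u i : ℝ) < (u (i + 1) : ℝ)) :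
    Nonempty (RamifiedGWitness p n K vK G Gser u) := by
  have : Fact p.Prime := ⟨hp⟩
  let u' : ℕ → ℤ := fun i => if i = 0 then 0 else u i
  have hu0 : u' 0 = 0 := rfl
  have huu : ∀ i, 1 ≤ i → u' i = u i := fun i hi => if_neg (by omega)
  have hM' : ∀ i, 1 ≤ i → i + 1 ≤ n → (1 + p * (p + 1)) * u' i < u' (i + 1) := by
    intro i hi hi'
    rw [huu i hi, huu (i + 1) (by omega)]
    exact_mod_cast hM i hi hi'
  have hlt' : ∀ k, k < n → u' k < u' (k + 1) := by
    intro k hk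
    rcases Nat.eq_zero_or_pos k with rfl | h
    · rw [hu0, huu _ le_rfl]; exact hpos 1 le_rfl hk
    · have h1 := hM' k h hk
      have h2 := hpos k h hk.le
      rw [huu k h] at h1 ⊢
      have h3 : (0 : ℤ) ≤ p * (p + 1) := by positivity
      nlinarith
  obtain ⟨L, _, _, w, ρ, hS⟩ := exists_stage hperf hG htop hlt hcard hu0 hlt'
    (fun i h h' => by rw [huu i h]; exact hpu i h h') hM' (le_refl n)
  exact final_witness hp hG htop hbot hlt hcard hu0 hlt' hS huu

theorem exists_growth_bound_for_ramified_G_extensions (p n : ℕ) (hp : p.Prime)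
    (hn : 1 ≤ n)
    (G : Type*) [Group G] [Finite G] (hG : Nat.card G = p ^ n)
    (Gser : ℕ → Subgroup G) [∀ j, (Gser j).Normal]
    (htop : Gser 0 = ⊤) (hbot : Gser n = ⊥)
    (hlt : ∀ j, j < n → Gser (j + 1) < Gser j)
    (hcard : ∀ j, j ≤ n → Nat.card (Gser j) = p ^ (n - j)) :
    ∃ M : ℝ, 1 ≤ M ∧
      ∀ (K : Type u) [Field K] [CharP K p] (vK : DVal K),
        vK.IsComplete → vK.PerfectResidue p →
        ∀ u : ℕ → ℤ,
          (∀ i, 1 ≤ i → i ≤ n → 0 < u i) →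
          (∀ i, 1 ≤ i → i ≤ n → ¬ (p : ℤ) ∣ u i) →
          (∀ i, 1 ≤ i → i + 1 ≤ n → M * (u i : ℝ) < (u (i + 1) : ℝ)) →
          Nonempty (RamifiedGWitness p n K vK G Gser u) := by
  refine ⟨((1 + p * (p + 1) : ℤ) : ℝ), ?_, ?_⟩
  · have : (1 : ℤ) ≤ 1 + p * (p + 1) := by
      have : (0 : ℤ) ≤ p * (p + 1) := by positivity
      omega
    exact_mod_cast this
  · intro K _ _ vK _ hperf u hpos hpu hM
    exact growth_aux p n hp G hG Gser htop hbot hlt hcard K vK hperf u hpos hpu hM
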